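/- For every integer d ≥ 1 there exists a finite constant C_d > 0, depending only on d, with the following property. Let n ≥ d, let X_1, …, X_n be independent random variables with values in arbitrary measurable spaces, and for J ⊆ {1,…,n} let F_J := σ(X_j, j ∈ J). Let ν > 0 and let W ∈ L⁴(P) be of the form W = Σ_{J ⊆ {1,…,n}, |J| = d} W_J, where each W_J is F_J-measurable, W_J ∈ L⁴(P), and E[W_J | F_K] = 0 almost surely whenever J ⊄ K, and suppose E[W] = 0 and E[W²] = 2ν. Set σ_J² := Var(W_J), ρ_n² := max_{1≤i≤n} Σ_{|K|=d, i∈K} σ_K², and D_n := max_{|J|=d} E[W_J⁴]/σ_J⁴. Then d₂(W, Z_ν) ≤ (max(1, 2/ν)/√3)·√|E[W⁴] − 12E[W³] − 12ν² + 48ν| + (((2√3 + 4√ν)·max(1, 2/ν) + 4√ν)/(3√d))·√(C_d·D_n·ρ_n²). -/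

import Mathlib

open MeasureTheory ProbabilityTheory Real

/-- The minimum Lipschitz constant `‖g'‖ = sup_{x ≠ y} |g x - g y| / |x - y|` of `g : ℝ → ℝ`. -/
noncomputable def lipConst (g : ℝ → ℝ) : ℝ :=
  sSup {c | ∃ x y : ℝ, x ≠ y ∧ c = |g x - g y| / |x - y|}

/-- The class `H₂` of test functions: differentiable `h` with `‖h^{(1)}‖ ≤ 1` (i.e. `h` is
1-Lipschitz) and `h'` Lipschitz with `‖h^{(2)}‖ ≤ 1` (i.e. `h'` is 1-Lipschitz). -/
def MemH2 (h : ℝ → ℝ) : Prop :=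
  Differentiable ℝ h ∧ LipschitzWith 1 h ∧ LipschitzWith 1 (deriv h)

/-- The distance `d₂` between two laws on `ℝ`, induced by the class `H₂`. -/
noncomputable def d2Dist (μ ν : Measure ℝ) : ℝ :=
  sSup {c | ∃ h : ℝ → ℝ, MemH2 h ∧ c = |(∫ x, h x ∂μ) - ∫ x, h x ∂ν|}

/-- The law of the centered Gamma random variable `Z_ν = 2 X_{ν/2,1} − ν`,
where `X_{ν/2,1} ∼ Γ(ν/2, 1)`. -/
noncomputable def centeredGammaLaw (ν : ℝ) : Measure ℝ :=
  (gammaMeasure (ν / 2) 1).map (fun x => 2 * x - ν)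


namespace DJ

lemma param_deriv (φ φ' : ℝ → ℝ → ℝ) (hφ : Continuous (Function.uncurry φ))
    (hφ' : Continuous (Function.uncurry φ'))
    (hd : ∀ t u, HasDerivAt (fun t => φ t u) (φ' t u) t) (t : ℝ) :
    HasDerivAt (fun t => ∫ u in (0:ℝ)..1, φ t u) (∫ u in (0:ℝ)..1, φ' t u) t := by
  obtain ⟨B, hB⟩ := ((isCompact_closedBall t 1).prod (isCompact_Icc (a := (0:ℝ)) (b := 1))).exists_bound_of_continuousOn
    hφ'.continuousOn
  refine (intervalIntegral.hasDerivAt_integral_of_dominated_loc_of_deriv_le (F := φ) (F' := φ')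
    (bound := fun _ => B) (Metric.ball_mem_nhds t one_pos) ?_ ?_ ?_ ?_ ?_ ?_).2
  · refine Filter.Eventually.of_forall fun s => ?_
    exact (hφ.comp (by fun_prop : Continuous fun u : ℝ => (s, u))).aestronglyMeasurable
  · exact (hφ.comp (by fun_prop : Continuous fun u : ℝ => (t, u))).intervalIntegrable _ _
  · exact (hφ'.comp (by fun_prop : Continuous fun u : ℝ => (t, u))).aestronglyMeasurable
  · refine Filter.Eventually.of_forall fun u hu s hs => ?_
    refine hB (s, u) ⟨Metric.ball_subset_closedBall hs, ?_⟩
    rw [Set.uIoc_of_le zero_le_one] at hu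
    exact ⟨hu.1.le, hu.2⟩
  · exact intervalIntegrable_const
  · exact Filter.Eventually.of_forall fun u hu s hs => hd s u

lemma param_cont (φ : ℝ → ℝ → ℝ) (hφ : Continuous (Function.uncurry φ)) :
    Continuous (fun t => ∫ u in (0:ℝ)..1, φ t u) :=
  intervalIntegral.continuous_parametric_intervalIntegral_of_continuous' hφ 0 1

/-- Regular solution of the Stein equation. -/
lemma stein_exists (ν : ℝ) (hν : 0 < ν) (k k1 k2 : ℝ → ℝ) (hk : ∀ t, HasDerivAt k (k1 t) t)
    (hk1 : ∀ t, HasDerivAt k1 (k2 t) t) (hk2 : Continuous k2) :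
    ∃ f f1 f2 : ℝ → ℝ, (∀ t, HasDerivAt f (f1 t) t) ∧ (∀ t, HasDerivAt f1 (f2 t) t) ∧ Continuous f2 ∧
      ∀ t, 2 * t * f1 t + (ν - t) * f t = k t := by
  have hkc : Continuous k := continuous_iff_continuousAt.2 fun t => (hk t).continuousAt
  have hk1c : Continuous k1 := continuous_iff_continuousAt.2 fun t => (hk1 t).continuousAt
  set p : ℝ → ℝ := fun u => u ^ (2 / ν) with hp
  have hq : 0 < 2 / ν := by positivity
  have hpc : Continuous p := continuous_id.rpow_const fun _ => Or.inr hq.le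
  set φ : ℝ → ℝ → ℝ := fun t u => exp (t * (1 - p u) / 2) * k (t * p u) with hφ
  set φ1 : ℝ → ℝ → ℝ := fun t u => exp (t * (1 - p u) / 2) *
    ((1 - p u) / 2 * k (t * p u) + p u * k1 (t * p u)) with hφ1
  set φ2 : ℝ → ℝ → ℝ := fun t u => exp (t * (1 - p u) / 2) *
    ((1 - p u) / 2 * ((1 - p u) / 2 * k (t * p u) + p u * k1 (t * p u))
      + ((1 - p u) / 2 * (p u * k1 (t * p u)) + p u * (p u * k2 (t * p u)))) with hφ2
  have c0 : Continuous (Function.uncurry φ) := by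
    simp only [hφ, Function.uncurry_def]; fun_prop
  have c1 : Continuous (Function.uncurry φ1) := by
    simp only [hφ1, Function.uncurry_def]; fun_prop
  have c2 : Continuous (Function.uncurry φ2) := by
    simp only [hφ2, Function.uncurry_def]; fun_prop
  have de : ∀ t u, HasDerivAt (fun t => exp (t * (1 - p u) / 2))
      (exp (t * (1 - p u) / 2) * ((1 - p u) / 2)) t := fun t u => by
    have : HasDerivAt (fun t => t * (1 - p u) / 2) ((1 - p u) / 2) t := by
      simpa using ((hasDerivAt_id t).mul_const (1 - p u)).div_const 2
    exact this.exp
  have dl : ∀ t u, HasDerivAt (fun t => t * p u) (p u) t := fun t u => by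
    simpa using (hasDerivAt_id t).mul_const (p u)
  have dk : ∀ t u, HasDerivAt (fun t => k (t * p u)) (k1 (t * p u) * p u) t := fun t u =>
    (hk (t * p u)).comp t (dl t u)
  have dk1 : ∀ t u, HasDerivAt (fun t => k1 (t * p u)) (k2 (t * p u) * p u) t := fun t u =>
    (hk1 (t * p u)).comp t (dl t u)
  have d0 : ∀ t u, HasDerivAt (fun t => φ t u) (φ1 t u) t := fun t u => by
    refine ((de t u).mul (dk t u)).congr_deriv ?_
    simp only [hφ1]; ring
  have d1 : ∀ t u, HasDerivAt (fun t => φ1 t u) (φ2 t u) t := fun t u => by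
    refine ((de t u).mul (((dk t u).const_mul ((1 - p u) / 2)).add
      ((dk1 t u).const_mul (p u)))).congr_deriv ?_
    simp only [hφ2, Pi.add_apply]; ring
  refine ⟨fun t => (1 / ν) * ∫ u in (0:ℝ)..1, φ t u, fun t => (1 / ν) * ∫ u in (0:ℝ)..1, φ1 t u,
    fun t => (1 / ν) * ∫ u in (0:ℝ)..1, φ2 t u,
    fun t => (param_deriv φ φ1 c0 c1 d0 t).const_mul _,
    fun t => (param_deriv φ1 φ2 c1 c2 d1 t).const_mul _,
    continuous_const.mul (param_cont φ2 c2), fun t => ?_⟩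
  have i0 : IntervalIntegrable (φ t) volume 0 1 :=
    (c0.comp (by fun_prop : Continuous fun u : ℝ => (t, u))).intervalIntegrable _ _
  have i1 : IntervalIntegrable (φ1 t) volume 0 1 :=
    (c1.comp (by fun_prop : Continuous fun u : ℝ => (t, u))).intervalIntegrable _ _
  have key : ∫ u in (0:ℝ)..1, ((1 - t / ν) * φ t u + (2 * t / ν) * φ1 t u)
      = 1 * φ t 1 - 0 * φ t 0 := by
    refine intervalIntegral.integral_eq_sub_of_hasDerivAt_of_le (f := fun u => u * φ t u) zero_le_one ?_ ?_ ?_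
    · have : Continuous (φ t) := c0.comp (by fun_prop : Continuous fun u : ℝ => (t, u))
      exact (continuous_id.mul this).continuousOn
    · intro u hu
      have dp : HasDerivAt p ((2 / ν) * u ^ (2 / ν - 1)) u :=
        Real.hasDerivAt_rpow_const (Or.inl hu.1.ne')
      have hup : u * u ^ (2 / ν - 1) = p u := by
        rw [Real.rpow_sub_one hu.1.ne']; field_simp [hu.1.ne']; rfl
      have e1 : HasDerivAt (fun u => exp (t * (1 - p u) / 2))
          (exp (t * (1 - p u) / 2) * (t * (0 - (2 / ν) * u ^ (2 / ν - 1)) / 2)) u :=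
        ((((hasDerivAt_const u (1:ℝ)).sub dp).const_mul t).div_const 2).exp
      have e2 : HasDerivAt (fun u => k (t * p u)) (k1 (t * p u) * (t * ((2 / ν) * u ^ (2 / ν - 1)))) u :=
        (hk (t * p u)).comp u (dp.const_mul t)
      refine ((hasDerivAt_id u).mul (e1.mul e2)).congr_deriv ?_
      simp only [hφ, hφ1, id, Pi.mul_apply, one_mul]
      have hν' := hν.ne'
      rw [show u * (exp (t * (1 - p u) / 2) * (t * (0 - 2 / ν * u ^ (2 / ν - 1)) / 2) * k (t * p u)
          + exp (t * (1 - p u) / 2) * (k1 (t * p u) * (t * (2 / ν * u ^ (2 / ν - 1)))))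
        = exp (t * (1 - p u) / 2) * (t * (2 / ν) * (u * u ^ (2 / ν - 1))) * (k1 (t * p u) - k (t * p u) / 2)
        by ring, hup]
      field_simp
      ring
    · exact (i0.const_mul _).add (i1.const_mul _)
  rw [intervalIntegral.integral_add (i0.const_mul _) (i1.const_mul _),
    intervalIntegral.integral_const_mul, intervalIntegral.integral_const_mul] at key
  have e : φ t 1 = k t := by simp [hφ, hp]
  rw [e] at key
  have hν' := hν.ne'
  field_simp at key ⊢
  linarith


lemma E_deriv (a t w : ℝ) (hw : 0 < w) (y : ℝ → ℝ) (y' g : ℝ)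
    (hd : HasDerivAt y y' (t * w)) (hode : 2 * (t * w) * y' + (a - t * w) * y (t * w) = g) :
    HasDerivAt (fun w => w ^ (a / 2) * exp (t * (1 - w) / 2) * y (t * w))
      (1 / 2 * w ^ (a / 2 - 1) * exp (t * (1 - w) / 2) * g) w := by
  have d1 : HasDerivAt (fun w : ℝ => w ^ (a / 2)) ((a / 2) * w ^ (a / 2 - 1)) w :=
    Real.hasDerivAt_rpow_const (Or.inl hw.ne')
  have d2 : HasDerivAt (fun w : ℝ => exp (t * (1 - w) / 2)) (exp (t * (1 - w) / 2) * (t * (0 - 1) / 2)) w :=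
    ((((hasDerivAt_const w (1:ℝ)).sub (hasDerivAt_id w)).const_mul t).div_const 2).exp
  have d3 : HasDerivAt (fun w : ℝ => y (t * w)) (y' * (t * 1)) w :=
    hd.comp w ((hasDerivAt_id w).const_mul t)
  refine ((d1.mul d2).mul d3).congr_deriv ?_
  have hup : w ^ (a / 2) = w * w ^ (a / 2 - 1) := by
    rw [Real.rpow_sub_one hw.ne']; field_simp
  simp only [Pi.mul_apply]
  rw [hup, ← hode]; ring

lemma lemL (a t : ℝ) (ha : 0 < a) (y y' g : ℝ → ℝ) (hy : Continuous y)
    (hd : ∀ w ∈ Set.Ioo (0:ℝ) 1, HasDerivAt y (y' (t * w)) (t * w))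
    (hode : ∀ w ∈ Set.Ioo (0:ℝ) 1, 2 * (t * w) * y' (t * w) + (a - t * w) * y (t * w) = g (t * w))
    (ψ ψ' : ℝ → ℝ) (hψ : ContinuousOn ψ (Set.Icc 0 1))
    (hψd : ∀ w ∈ Set.Ioo (0:ℝ) 1, HasDerivAt ψ (ψ' w) w)
    (hle : ∀ w ∈ Set.Ioo (0:ℝ) 1,
      1 / 2 * w ^ (a / 2 - 1) * exp (t * (1 - w) / 2) * g (t * w) ≤ ψ' w) :
    y t ≤ ψ 1 - ψ 0 := by
  have hmono : MonotoneOn (fun w => ψ w - w ^ (a / 2) * exp (t * (1 - w) / 2) * y (t * w))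
      (Set.Icc 0 1) := by
    have hD : ∀ w ∈ Set.Ioo (0:ℝ) 1, HasDerivAt
        (fun w => ψ w - w ^ (a / 2) * exp (t * (1 - w) / 2) * y (t * w))
        (ψ' w - 1 / 2 * w ^ (a / 2 - 1) * exp (t * (1 - w) / 2) * g (t * w)) w := fun w hw =>
      (hψd w hw).sub (E_deriv a t w hw.1 y _ _ (hd w hw) (hode w hw))
    refine monotoneOn_of_deriv_nonneg (convex_Icc 0 1) ?_ ?_ ?_
    · refine hψ.sub (Continuous.continuousOn ?_)
      have : Continuous (fun w : ℝ => w ^ (a / 2)) :=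
        continuous_id.rpow_const fun _ => Or.inr (by positivity)
      fun_prop
    · rw [interior_Icc]
      exact fun w hw => (hD w hw).differentiableAt.differentiableWithinAt
    · rw [interior_Icc]
      intro w hw
      rw [(hD w hw).deriv]
      linarith [hle w hw]
  have := hmono (Set.left_mem_Icc.2 zero_le_one) (Set.right_mem_Icc.2 zero_le_one) zero_le_one
  simp only [sub_self, mul_zero, zero_div, exp_zero, Real.one_rpow, mul_one, one_mul] at this
  rw [Real.zero_rpow (by positivity)] at this
  simp at this
  linarith

lemma lemR (a t : ℝ) (ht : 0 < t) (y y' g : ℝ → ℝ)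
    (hd : ∀ w ∈ Set.Ici (1:ℝ), HasDerivAt y (y' (t * w)) (t * w))
    (hode : ∀ w ∈ Set.Ici (1:ℝ), 2 * (t * w) * y' (t * w) + (a - t * w) * y (t * w) = g (t * w))
    (hlim : Filter.Tendsto (fun s => s ^ (a / 2) * exp (-s / 2) * y s) Filter.atTop (nhds 0))
    (ψ ψ' : ℝ → ℝ) (hψ0 : ∀ w ∈ Set.Ici (1:ℝ), 0 ≤ ψ w)
    (hψd : ∀ w ∈ Set.Ici (1:ℝ), HasDerivAt ψ (ψ' w) w)
    (hle : ∀ w ∈ Set.Ici (1:ℝ),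
      ψ' w ≤ 1 / 2 * w ^ (a / 2 - 1) * exp (t * (1 - w) / 2) * g (t * w)) :
    y t ≤ ψ 1 := by
  have hD : ∀ w ∈ Set.Ici (1:ℝ), HasDerivAt
      (fun w => w ^ (a / 2) * exp (t * (1 - w) / 2) * y (t * w) - ψ w)
      (1 / 2 * w ^ (a / 2 - 1) * exp (t * (1 - w) / 2) * g (t * w) - ψ' w) w := fun w hw =>
    (E_deriv a t w (lt_of_lt_of_le one_pos hw) y _ _ (hd w hw) (hode w hw)).sub (hψd w hw)
  have hmono : MonotoneOn (fun w => w ^ (a / 2) * exp (t * (1 - w) / 2) * y (t * w) - ψ w)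
      (Set.Ici 1) := by
    refine monotoneOn_of_deriv_nonneg (convex_Ici 1) ?_ ?_ ?_
    · exact fun w hw => (hD w hw).continuousAt.continuousWithinAt
    · exact fun w hw => (hD w (interior_subset hw)).differentiableAt.differentiableWithinAt
    · intro w hw
      rw [(hD w (interior_subset hw)).deriv]
      linarith [hle w (interior_subset hw)]
  have hE : Filter.Tendsto (fun w => w ^ (a / 2) * exp (t * (1 - w) / 2) * y (t * w))
      Filter.atTop (nhds 0) := by
    have h1 := (hlim.comp (Filter.tendsto_id.const_mul_atTop ht)).const_mul
      ((t ^ (a / 2))⁻¹ * exp (t / 2))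
    rw [mul_zero] at h1
    refine h1.congr' ?_
    filter_upwards [Filter.eventually_gt_atTop 0] with w hw
    simp only [Function.comp, id]
    rw [Real.mul_rpow ht.le hw.le, show t * (1 - w) / 2 = t / 2 + -(t * w) / 2 by ring, exp_add]
    have : t ^ (a / 2) ≠ 0 := (Real.rpow_pos_of_pos ht _).ne'
    field_simp
  have hle0 : (1:ℝ) ^ (a / 2) * exp (t * (1 - 1) / 2) * y (t * 1) - ψ 1 ≤ 0 := by
    refine ge_of_tendsto hE ?_
    filter_upwards [Filter.eventually_ge_atTop 1] with w hw
    have := hmono (Set.self_mem_Ici) hw hw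
    simp only at this
    linarith [hψ0 w hw]
  simp at hle0
  exact hle0

/-- two-sided version of `lemL` -/
lemma lemL2 (a t G : ℝ) (ha : 0 < a) (y y' g : ℝ → ℝ) (hy : Continuous y)
    (hd : ∀ s, s ≠ 0 → HasDerivAt y (y' s) s)
    (hode : ∀ s, s ≠ 0 → 2 * s * y' s + (a - s) * y s = g s) (hg : ∀ s, |g s| ≤ G) (ht : t ≠ 0)
    (ψ ψ' : ℝ → ℝ) (hψ : ContinuousOn ψ (Set.Icc 0 1))
    (hψd : ∀ w ∈ Set.Ioo (0:ℝ) 1, HasDerivAt ψ (ψ' w) w)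
    (hle : ∀ w ∈ Set.Ioo (0:ℝ) 1, 1 / 2 * w ^ (a / 2 - 1) * exp (t * (1 - w) / 2) ≤ ψ' w) :
    |y t| ≤ G * (ψ 1 - ψ 0) := by
  have hG : 0 ≤ G := (abs_nonneg _).trans (hg 0)
  have hne : ∀ w ∈ Set.Ioo (0:ℝ) 1, t * w ≠ 0 := fun w hw => mul_ne_zero ht hw.1.ne'
  have key : ∀ g' : ℝ → ℝ, (∀ s, |g' s| ≤ G) → ∀ w ∈ Set.Ioo (0:ℝ) 1,
      1 / 2 * w ^ (a / 2 - 1) * exp (t * (1 - w) / 2) * g' (t * w) ≤ G * ψ' w := by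
    intro g' hg' w hw
    have h0 : 0 ≤ 1 / 2 * w ^ (a / 2 - 1) * exp (t * (1 - w) / 2) := by
      have := Real.rpow_nonneg hw.1.le (a / 2 - 1)
      positivity
    calc _ ≤ 1 / 2 * w ^ (a / 2 - 1) * exp (t * (1 - w) / 2) * G :=
          mul_le_mul_of_nonneg_left ((le_abs_self _).trans (hg' _)) h0
      _ ≤ ψ' w * G := mul_le_mul_of_nonneg_right (hle w hw) hG
      _ = _ := mul_comm _ _
  have h1 := lemL a t ha y y' g hy (fun w hw => hd _ (hne w hw)) (fun w hw => hode _ (hne w hw))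
    (fun w => G * ψ w) (fun w => G * ψ' w) (continuousOn_const.mul hψ)
    (fun w hw => (hψd w hw).const_mul G) (key g hg)
  have h2 := lemL a t ha (fun s => - y s) (fun s => - y' s) (fun s => - g s) hy.neg
    (fun w hw => (hd _ (hne w hw)).neg)
    (fun w hw => by rw [← hode _ (hne w hw)]; ring)
    (fun w => G * ψ w) (fun w => G * ψ' w) (continuousOn_const.mul hψ)
    (fun w hw => (hψd w hw).const_mul G) (key _ (fun s => by rw [abs_neg]; exact hg s))
  rw [abs_le]
  constructor <;> linarith

/-- two-sided version of `lemR` -/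
lemma lemR2 (a t G : ℝ) (y y' g : ℝ → ℝ)
    (hd : ∀ s, s ≠ 0 → HasDerivAt y (y' s) s)
    (hode : ∀ s, s ≠ 0 → 2 * s * y' s + (a - s) * y s = g s) (hg : ∀ s, |g s| ≤ G) (ht : 0 < t)
    (hlim : Filter.Tendsto (fun s => s ^ (a / 2) * exp (-s / 2) * y s) Filter.atTop (nhds 0))
    (ψ ψ' : ℝ → ℝ) (hψ0 : ∀ w ∈ Set.Ici (1:ℝ), 0 ≤ ψ w)
    (hψd : ∀ w ∈ Set.Ici (1:ℝ), HasDerivAt ψ (ψ' w) w)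
    (hle : ∀ w ∈ Set.Ici (1:ℝ), 1 / 2 * w ^ (a / 2 - 1) * exp (t * (1 - w) / 2) ≤ - ψ' w) :
    |y t| ≤ G * ψ 1 := by
  have hG : 0 ≤ G := (abs_nonneg _).trans (hg 0)
  have hp : ∀ w ∈ Set.Ici (1:ℝ), 0 < w := fun w hw => lt_of_lt_of_le one_pos hw
  have hne : ∀ w ∈ Set.Ici (1:ℝ), t * w ≠ 0 := fun w hw => mul_ne_zero ht.ne' (hp w hw).ne'
  have key : ∀ g' : ℝ → ℝ, (∀ s, |g' s| ≤ G) → ∀ w ∈ Set.Ici (1:ℝ),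
      G * ψ' w ≤ 1 / 2 * w ^ (a / 2 - 1) * exp (t * (1 - w) / 2) * g' (t * w) := by
    intro g' hg' w hw
    have h0 : 0 ≤ 1 / 2 * w ^ (a / 2 - 1) * exp (t * (1 - w) / 2) := by
      have := Real.rpow_nonneg (hp w hw).le (a / 2 - 1)
      positivity
    have h1 := mul_le_mul_of_nonneg_left (neg_le_of_abs_le (hg' (t * w))) h0
    have h2 := mul_le_mul_of_nonneg_right (hle w hw) hG
    linarith
  have h1 := lemR a t ht y y' g (fun w hw => hd _ (hne w hw)) (fun w hw => hode _ (hne w hw)) hlim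
    (fun w => G * ψ w) (fun w => G * ψ' w) (fun w hw => mul_nonneg hG (hψ0 w hw))
    (fun w hw => (hψd w hw).const_mul G) (key g hg)
  have h2 := lemR a t ht (fun s => - y s) (fun s => - y' s) (fun s => - g s)
    (fun w hw => (hd _ (hne w hw)).neg)
    (fun w hw => by rw [← hode _ (hne w hw)]; ring)
    (by simpa using hlim.neg)
    (fun w => G * ψ w) (fun w => G * ψ' w) (fun w hw => mul_nonneg hG (hψ0 w hw))
    (fun w hw => (hψd w hw).const_mul G) (key _ (fun s => by rw [abs_neg]; exact hg s))
  rw [abs_le]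
  constructor <;> linarith

lemma psi_deriv (b t w : ℝ) (hw : 0 < w) :
    HasDerivAt (fun w => w ^ b * exp (t * (1 - w) / 2))
      (w ^ (b - 1) * exp (t * (1 - w) / 2) * (b - t * w / 2)) w := by
  have := E_deriv (2 * b) t w hw (fun _ => 1) 0 (2 * b - t * w) (hasDerivAt_const _ _) (by ring)
  simp only [mul_one] at this
  rw [show 2 * b / 2 = b by ring] at this
  refine this.congr_deriv ?_
  ring

/-- crude left bounds -/
lemma lemL3 (a t G : ℝ) (ha : 0 < a) (y y' g : ℝ → ℝ) (hy : Continuous y)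
    (hd : ∀ s, s ≠ 0 → HasDerivAt y (y' s) s)
    (hode : ∀ s, s ≠ 0 → 2 * s * y' s + (a - s) * y s = g s) (hg : ∀ s, |g s| ≤ G) (ht : t ≠ 0)
    (B : ℝ) (hB : 0 < B) (hBa : B ≤ a) (hBt : B ≤ a - t) : |y t| ≤ G / B := by
  have h := lemL2 a t G ha y y' g hy hd hode hg ht
    (fun w => w ^ (a / 2) * exp (t * (1 - w) / 2) / B)
    (fun w => w ^ (a / 2 - 1) * exp (t * (1 - w) / 2) * (a / 2 - t * w / 2) / B) ?_
    (fun w hw => (psi_deriv (a / 2) t w hw.1).div_const B) ?_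
  · refine h.trans (le_of_eq ?_)
    simp only [sub_self, mul_zero, zero_div, exp_zero, Real.one_rpow, mul_one]
    rw [Real.zero_rpow (by positivity)]
    ring
  · have : Continuous (fun w : ℝ => w ^ (a / 2)) :=
      continuous_id.rpow_const fun _ => Or.inr (by positivity)
    exact Continuous.continuousOn (by fun_prop)
  · intro w hw
    have h0 : 0 ≤ w ^ (a / 2 - 1) * exp (t * (1 - w) / 2) := by
      have := Real.rpow_nonneg hw.1.le (a / 2 - 1)
      positivity
    have h1 : B ≤ a - t * w := by
      rcases le_total 0 t with h | h
      · nlinarith [hw.1, hw.2]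
      · nlinarith [hw.1, hw.2]
    rw [le_div_iff₀ hB]
    nlinarith

/-- crude right bound -/
lemma lemR3 (a t G : ℝ) (y y' g : ℝ → ℝ)
    (hd : ∀ s, s ≠ 0 → HasDerivAt y (y' s) s)
    (hode : ∀ s, s ≠ 0 → 2 * s * y' s + (a - s) * y s = g s) (hg : ∀ s, |g s| ≤ G) (ht : 0 < t)
    (hlim : Filter.Tendsto (fun s => s ^ (a / 2) * exp (-s / 2) * y s) Filter.atTop (nhds 0))
    (hta : a < t) : |y t| ≤ G / (t - a) := by
  have hB : 0 < t - a := by linarith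
  have h := lemR2 a t G y y' g hd hode hg ht hlim
    (fun w => w ^ (a / 2) * exp (t * (1 - w) / 2) / (t - a))
    (fun w => w ^ (a / 2 - 1) * exp (t * (1 - w) / 2) * (a / 2 - t * w / 2) / (t - a)) ?_
    (fun w hw => (psi_deriv (a / 2) t w (lt_of_lt_of_le one_pos hw)).div_const _) ?_
  · refine h.trans (le_of_eq ?_)
    simp only [sub_self, mul_zero, zero_div, exp_zero, Real.one_rpow, mul_one]
    ring
  · intro w hw
    have := Real.rpow_nonneg (zero_le_one.trans hw) (a / 2)
    positivity
  · intro w hw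
    have h0 : 0 ≤ w ^ (a / 2 - 1) * exp (t * (1 - w) / 2) := by
      have := Real.rpow_nonneg (zero_le_one.trans hw) (a / 2 - 1)
      positivity
    have hw' : 1 ≤ w := hw
    have h1 : t - a ≤ t * w - a := by nlinarith
    rw [← neg_div, le_div_iff₀ hB]
    nlinarith

lemma gamma_int (θ : ℝ) (hθ : 0 < θ) (g : ℝ → ℝ) (hg : Continuous g) (A B : ℝ)
    (hAB : ∀ s, 0 < s → |g s| ≤ A + B * s) :
    IntegrableOn (fun s => s ^ (θ - 1) * exp (-s) * g s) (Set.Ioi 0) := by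
  have h1 := (Real.GammaIntegral_convergent hθ).const_mul A
  have h2 := (Real.GammaIntegral_convergent (by linarith : 0 < θ + 1)).const_mul B
  refine Integrable.mono' (h1.add h2) ?_ ?_
  · refine ContinuousOn.aestronglyMeasurable ?_ measurableSet_Ioi
    refine ContinuousOn.mul (ContinuousOn.mul ?_ ?_) hg.continuousOn
    · exact fun s hs => (Real.continuousAt_rpow_const _ _ (Or.inl (ne_of_gt hs))).continuousWithinAt
    · fun_prop
  · refine (ae_restrict_iff' measurableSet_Ioi).2 (Filter.Eventually.of_forall fun s hs => ?_)
    have hs' : (0:ℝ) < s := hs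
    have h0 : 0 ≤ s ^ (θ - 1) * exp (-s) := by
      have := Real.rpow_nonneg hs'.le (θ - 1)
      positivity
    rw [norm_mul, Real.norm_of_nonneg h0, Real.norm_eq_abs]
    refine (mul_le_mul_of_nonneg_left (hAB s hs) h0).trans (le_of_eq ?_)
    simp only [Pi.add_apply]
    have hup : s ^ (θ + 1 - 1) = s * s ^ (θ - 1) := by
      rw [add_sub_cancel_right, Real.rpow_sub_one hs'.ne']; field_simp
    rw [hup]; ring

lemma gamma_mean (θ : ℝ) (hθ : 0 < θ) :
    ∫ s in Set.Ioi 0, s ^ (θ - 1) * exp (-s) * (2 * θ - 2 * s) = 0 := by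
  have h1 := (Real.GammaIntegral_convergent hθ).const_mul (2 * θ)
  have h2 := (Real.GammaIntegral_convergent (by linarith : 0 < θ + 1)).const_mul 2
  have e : ∫ s in Set.Ioi 0, s ^ (θ - 1) * exp (-s) * (2 * θ - 2 * s)
      = ∫ s in Set.Ioi 0, (2 * θ * (exp (-s) * s ^ (θ - 1)) - 2 * (exp (-s) * s ^ (θ + 1 - 1))) := by
    refine setIntegral_congr_fun measurableSet_Ioi fun s hs => ?_
    have hs' : (0:ℝ) < s := hs
    have hup : s ^ (θ + 1 - 1) = s * s ^ (θ - 1) := by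
      rw [add_sub_cancel_right, Real.rpow_sub_one hs'.ne']; field_simp
    simp only [hup]; ring
  rw [e, integral_sub h1 h2, integral_const_mul, integral_const_mul, ← Real.Gamma_eq_integral hθ,
    ← Real.Gamma_eq_integral (by linarith), Real.Gamma_add_one hθ.ne']
  ring

lemma stein_pos (ν : ℝ) (hν : 0 < ν) (y y1 g : ℝ → ℝ) (hy : ∀ t, HasDerivAt y (y1 t) t)
    (hode : ∀ t, 2 * t * y1 t + (ν - t) * y t = g t) (hg : Antitone g)
    (hIntg : IntegrableOn (fun s => s ^ (ν / 2 - 1) * exp (-s) * g (2 * s)) (Set.Ioi 0))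
    (h0 : ∫ s in Set.Ioi 0, s ^ (ν / 2 - 1) * exp (-s) * g (2 * s) = 0) (t : ℝ) : 0 ≤ y t := by
  have hyc : Continuous y := continuous_iff_continuousAt.2 fun t => (hy t).continuousAt
  have hrc : Continuous (fun w : ℝ => w ^ (ν / 2)) :=
    continuous_id.rpow_const fun _ => Or.inr (by positivity)
  have hg0 : 0 ≤ g 0 := by
    by_contra hneg
    push Not at hneg
    have hI := (Real.GammaIntegral_convergent (by positivity : 0 < ν / 2))
    have := setIntegral_mono_on hIntg (hI.const_mul (g 0)) measurableSet_Ioi (fun s hs => by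
      have hs' : (0:ℝ) < s := hs
      have h0 : 0 ≤ s ^ (ν / 2 - 1) * exp (-s) := by
        have := Real.rpow_nonneg hs'.le (ν / 2 - 1)
        positivity
      have := mul_le_mul_of_nonneg_left (hg (by linarith : (0:ℝ) ≤ 2 * s)) h0
      linarith)
    rw [h0, integral_const_mul, ← Real.Gamma_eq_integral (by positivity)] at this
    have hG := Real.Gamma_pos_of_pos (by positivity : 0 < ν / 2)
    nlinarith
  have hlim : Filter.Tendsto (fun s => s ^ (ν / 2) * exp (-s / 2) * y s) Filter.atTop (nhds 0) := by
    set E : ℝ → ℝ := fun w => w ^ (ν / 2) * exp (2 * (1 - w) / 2) * y (2 * w) with hE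
    set E' : ℝ → ℝ := fun w => 1 / 2 * w ^ (ν / 2 - 1) * exp (2 * (1 - w) / 2) * g (2 * w) with hE'
    have hd : ∀ w ∈ Set.Ioi (0:ℝ), HasDerivAt E (E' w) w := fun w hw =>
      E_deriv ν 2 w hw y _ _ (hy _) (hode _)
    have hE'e : E' = fun w => (1 / 2 * exp 1) * (w ^ (ν / 2 - 1) * exp (-w) * g (2 * w)) := by
      funext w
      simp only [hE']
      rw [show 2 * (1 - w) / 2 = 1 + -w by ring, exp_add]; ring
    have hi : IntegrableOn E' (Set.Ioi 0) := by
      rw [hE'e]; exact hIntg.const_mul _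
    have hi0 : ∫ w in Set.Ioi 0, E' w = 0 := by
      rw [hE'e, integral_const_mul, h0, mul_zero]
    have hl := tendsto_limUnder_of_hasDerivAt_of_integrableOn_Ioi hd hi
    have hEc : Continuous E := by simp only [hE]; fun_prop
    have := integral_Ioi_of_hasDerivAt_of_tendsto hEc.continuousWithinAt hd hi hl
    have hE0 : E 0 = 0 := by
      simp only [hE]; rw [Real.zero_rpow (by positivity)]; ring
    rw [hi0, hE0, sub_zero] at this
    rw [← this] at hl
    have h1 := (hl.comp (Filter.tendsto_id.atTop_div_const (two_pos))).const_mul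
      ((2:ℝ) ^ (ν / 2) * exp (-1))
    rw [mul_zero] at h1
    refine h1.congr' ?_
    filter_upwards [Filter.eventually_gt_atTop 0] with s hs
    simp only [Function.comp, id, hE]
    rw [Real.div_rpow hs.le two_pos.le, show 2 * (1 - s / 2) / 2 = 1 + -s / 2 by ring, exp_add, exp_neg,
      show 2 * (s / 2) = s by ring]
    have h2 : (2:ℝ) ^ (ν / 2) ≠ 0 := (Real.rpow_pos_of_pos two_pos _).ne'
    have h3 := (exp_pos 1).ne'
    field_simp
  have hL : (∀ w ∈ Set.Ioo (0:ℝ) 1, 0 ≤ g (t * w)) → 0 ≤ y t := by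
    intro hh
    have := lemL ν t hν (fun s => - y s) (fun s => - y1 s) (fun s => - g s) hyc.neg
      (fun w _ => (hy _).neg) (fun w _ => by rw [← hode]; ring) (fun _ => 0) (fun _ => 0)
      continuousOn_const (fun w _ => hasDerivAt_const _ _) (fun w hw => by
        have h1 : 0 ≤ 1 / 2 * w ^ (ν / 2 - 1) * exp (t * (1 - w) / 2) := by
          have := Real.rpow_nonneg hw.1.le (ν / 2 - 1)
          positivity
        nlinarith [mul_nonneg h1 (hh w hw)])
    linarith
  rcases le_or_gt t 0 with ht | ht
  · exact hL fun w hw => hg0.trans (hg (mul_nonpos_of_nonpos_of_nonneg ht hw.1.le))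
  rcases le_or_gt 0 (g t) with hgt | hgt
  · exact hL fun w hw => hgt.trans (hg (by nlinarith [hw.1, hw.2]))
  · have := lemR ν t ht (fun s => - y s) (fun s => - y1 s) (fun s => - g s)
      (fun w _ => (hy _).neg) (fun w _ => by rw [← hode]; ring) (by simpa using hlim.neg)
      (fun _ => 0) (fun _ => 0) (fun _ _ => le_rfl) (fun w _ => hasDerivAt_const _ _) (fun w hw => by
        have hw' : 1 ≤ w := hw
        have h1 : 0 ≤ 1 / 2 * w ^ (ν / 2 - 1) * exp (t * (1 - w) / 2) := by
          have := Real.rpow_nonneg (zero_le_one.trans hw') (ν / 2 - 1)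
          positivity
        have h2 : g (t * w) ≤ g t := hg (by nlinarith)
        nlinarith [mul_nonneg h1 (by linarith : 0 ≤ - g (t * w))])
    linarith

lemma stein_f_bound (ν : ℝ) (hν : 0 < ν) (k f f1 : ℝ → ℝ) (hf : ∀ t, HasDerivAt f (f1 t) t)
    (hk : ∀ x y, |k x - k y| ≤ |x - y|) (hkc : Continuous k)
    (hode : ∀ t, 2 * t * f1 t + (ν - t) * f t = k t)
    (h0 : ∫ s in Set.Ioi 0, s ^ (ν / 2 - 1) * exp (-s) * k (2 * s) = 0) (t : ℝ) : |f t| ≤ 1 := by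
  have hθ : 0 < ν / 2 := by positivity
  have hki : IntegrableOn (fun s => s ^ (ν / 2 - 1) * exp (-s) * k (2 * s)) (Set.Ioi 0) := by
    refine gamma_int (ν / 2) hθ (fun s => k (2 * s)) (by fun_prop) (|k 0|) 2 fun s hs => ?_
    have h1 := hk (2 * s) 0
    rw [sub_zero, abs_of_pos (by linarith : 0 < 2 * s)] at h1
    have h2 := abs_add_le (k (2 * s) - k 0) (k 0)
    rw [sub_add_cancel] at h2
    linarith
  have hmi : IntegrableOn (fun s => s ^ (ν / 2 - 1) * exp (-s) * (2 * (ν / 2) - 2 * s)) (Set.Ioi 0) := by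
    refine gamma_int (ν / 2) hθ (fun s => 2 * (ν / 2) - 2 * s) (by fun_prop) ν 2 fun s hs => ?_
    rw [abs_le]; constructor <;> linarith
  have hm := gamma_mean (ν / 2) hθ
  have hanti : ∀ x y, x ≤ y → |k x - k y| ≤ y - x := fun x y hxy => by
    have := hk x y
    rwa [abs_sub_comm x y, abs_of_nonneg (by linarith : 0 ≤ y - x)] at this
  have p1 : 0 ≤ f t + 1 := by
    refine stein_pos ν hν (fun t => f t + 1) f1 (fun t => k t + (ν - t)) (fun t => (hf t).add_const 1)
      (fun t => by rw [← hode]; ring) ?_ ?_ ?_ t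
    · intro x y hxy
      have := abs_le.1 (hanti x y hxy)
      simp only; linarith
    · refine (hki.add hmi).congr (Filter.Eventually.of_forall fun s => ?_)
      simp only [Pi.add_apply]; ring
    · have e := integral_add hki hmi
      rw [h0, hm, add_zero] at e
      refine Eq.trans ?_ e
      refine integral_congr_ae (Filter.Eventually.of_forall fun s => ?_)
      simp only; ring
  have p2 : 0 ≤ 1 - f t := by
    refine stein_pos ν hν (fun t => 1 - f t) (fun t => - f1 t) (fun t => (ν - t) - k t)
      (fun t => (hf t).const_sub 1)
      (fun t => by rw [← hode]; ring) ?_ ?_ ?_ t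
    · intro x y hxy
      have := abs_le.1 (hanti x y hxy)
      simp only; linarith
    · refine (hmi.sub hki).congr (Filter.Eventually.of_forall fun s => ?_)
      simp only [Pi.sub_apply]; ring
    · have e := integral_sub hmi hki
      rw [h0, hm, sub_zero] at e
      refine Eq.trans ?_ e
      refine integral_congr_ae (Filter.Eventually.of_forall fun s => ?_)
      simp only; ring
  rw [abs_le]; constructor <;> linarith
lemma exp_53 : exp (5 / 3) ≤ 5.444 := by
  refine le_of_pow_le_pow_left₀ (n := 3) (by norm_num) (by norm_num) ?_
  rw [← exp_nat_mul]
  have h : ((3:ℕ):ℝ) * (5 / 3) = (5:ℕ) * 1 := by norm_num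
  rw [h, exp_nat_mul]
  have h1 := Real.exp_one_lt_d9.le
  calc exp 1 ^ 5 ≤ 2.7182818286 ^ 5 := pow_le_pow_left₀ (exp_pos 1).le h1 5
    _ ≤ _ := by norm_num

lemma dexp (c w : ℝ) : HasDerivAt (fun w => exp (c * (1 - w))) (exp (c * (1 - w)) * (-c)) w := by
  have : HasDerivAt (fun w => c * (1 - w)) (-c) w := by
    simpa using ((hasDerivAt_id w).const_sub 1).const_mul c
  exact this.exp

lemma dpsi (c w A B : ℝ) : HasDerivAt (fun w => (A + B * w) * exp (c * (1 - w)))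
    ((B - c * A - c * B * w) * exp (c * (1 - w))) w := by
  have h1 : HasDerivAt (fun w => A + B * w) B w := by
    simpa using ((hasDerivAt_id w).const_mul B).const_add A
  refine (h1.mul (dexp c w)).congr_deriv ?_
  ring

lemma rpow_le_exp' (w x : ℝ) (hw : 0 < w) (hx : 0 ≤ x) : w ^ x ≤ exp (x * (w - 1)) := by
  rw [Real.rpow_def_of_pos hw, exp_le_exp, mul_comm]
  exact mul_le_mul_of_nonneg_left (Real.log_le_sub_one_of_pos hw) hx

/-- Bound for the first derivative. -/
lemma stein_f1_bound (ν : ℝ) (hν : 0 < ν) (y y' g : ℝ → ℝ) (hy : Continuous y)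
    (hd : ∀ s, s ≠ 0 → HasDerivAt y (y' s) s)
    (hode : ∀ s, s ≠ 0 → 2 * s * y' s + ((ν + 2) - s) * y s = g s) (hg : ∀ s, |g s| ≤ 2)
    (hlim : Filter.Tendsto (fun s => s ^ ((ν + 2) / 2) * exp (-s / 2) * y s) Filter.atTop (nhds 0))
    (t : ℝ) (ht0 : t ≠ 0) : |y t| ≤ max 1 (2 / ν) := by
  have he := exp_53
  have hexp : ∀ r : ℝ, (ν + 2) / 2 - 1 = ν / 2 := fun _ => by ring
  have hexp := hexp 0
  rcases lt_or_gt_of_ne ht0 with htn | htp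
  · have := lemL3 (ν + 2) t 2 (by positivity) y y' g hy hd hode hg ht0 2 two_pos (by linarith) (by linarith)
    refine this.trans ?_
    rw [div_self two_ne_zero]
    exact le_max_left _ _
  rcases le_total 2 ν with h2 | h2
  · -- large `ν`
    refine le_trans ?_ (le_max_left _ _)
    rcases le_total t (ν + 4 / 3) with hl | hr
    · have := lemL2 (ν + 2) t 2 (by positivity) y y' g hy hd hode hg ht0
        (fun w => (-(1 / 2 * (9 / 25)) + -(1 / 2 * (3 / 5)) * w) * exp (5 / 3 * (1 - w)))
        (fun w => (-(1 / 2 * (3 / 5)) - 5 / 3 * -(1 / 2 * (9 / 25)) - 5 / 3 * -(1 / 2 * (3 / 5)) * w)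
          * exp (5 / 3 * (1 - w)))
        (Continuous.continuousOn (by fun_prop)) (fun w _ => dpsi _ _ _ _) (fun w hw => by
          have hw0 := hw.1
          have hw1 := hw.2
          have e1 : w ^ (ν / 2) ≤ w * exp ((ν / 2 - 1) * (w - 1)) := by
            have h := rpow_le_exp' w (ν / 2 - 1) hw.1 (by linarith)
            have hup : w ^ (ν / 2) = w * w ^ (ν / 2 - 1) := by
              rw [Real.rpow_sub_one hw0.ne']; field_simp
            rw [hup]
            exact mul_le_mul_of_nonneg_left h hw0.le
          have e2 : w ^ (ν / 2) * exp (t * (1 - w) / 2) ≤ w * exp (5 / 3 * (1 - w)) := by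
            calc w ^ (ν / 2) * exp (t * (1 - w) / 2)
                ≤ w * exp ((ν / 2 - 1) * (w - 1)) * exp (t * (1 - w) / 2) :=
                  mul_le_mul_of_nonneg_right e1 (exp_pos _).le
              _ = w * exp ((ν / 2 - 1) * (w - 1) + t * (1 - w) / 2) := by rw [exp_add]; ring
              _ ≤ _ := by
                refine mul_le_mul_of_nonneg_left (exp_le_exp.2 ?_) hw0.le
                nlinarith
          rw [hexp]
          linarith)
      norm_num at this ⊢
      linarith
    · have := lemR2 (ν + 2) t 2 y y' g hd hode hg htp hlim
        (fun w => ((1 / 2 * (9 / 25)) + (1 / 2 * (3 / 5)) * w) * exp (5 / 3 * (1 - w)))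
        (fun w => ((1 / 2 * (3 / 5)) - 5 / 3 * (1 / 2 * (9 / 25)) - 5 / 3 * (1 / 2 * (3 / 5)) * w)
          * exp (5 / 3 * (1 - w)))
        (fun w hw => by
          have hw' : 1 ≤ w := hw
          positivity) (fun w _ => dpsi _ _ _ _) (fun w hw => by
          have hw1 : 1 ≤ w := hw
          have hw0 : 0 < w := by linarith
          have e1 : w ^ (ν / 2) ≤ w * exp ((ν / 2 - 1) * (w - 1)) := by
            have h := rpow_le_exp' w (ν / 2 - 1) hw0 (by linarith)
            have hup : w ^ (ν / 2) = w * w ^ (ν / 2 - 1) := by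
              rw [Real.rpow_sub_one hw0.ne']; field_simp
            rw [hup]
            exact mul_le_mul_of_nonneg_left h hw0.le
          have e2 : w ^ (ν / 2) * exp (t * (1 - w) / 2) ≤ w * exp (5 / 3 * (1 - w)) := by
            calc w ^ (ν / 2) * exp (t * (1 - w) / 2)
                ≤ w * exp ((ν / 2 - 1) * (w - 1)) * exp (t * (1 - w) / 2) :=
                  mul_le_mul_of_nonneg_right e1 (exp_pos _).le
              _ = w * exp ((ν / 2 - 1) * (w - 1) + t * (1 - w) / 2) := by rw [exp_add]; ring
              _ ≤ _ := by
                refine mul_le_mul_of_nonneg_left (exp_le_exp.2 ?_) hw0.le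
                nlinarith
          rw [hexp]
          linarith)
      norm_num at this ⊢
      linarith
  · -- small `ν`
    have hθ1 : ν / 2 ≤ 1 := by linarith
    have hθ0 : 0 < ν / 2 := by linarith
    rcases le_total t (5 / 3 * ν) with hl | hr
    · refine le_trans ?_ (le_max_left _ _)
      have := lemL2 (ν + 2) t 2 (by positivity) y y' g hy hd hode hg ht0
        (fun w => 1 / 2 * (1 - ν / 2) * w + ν / 2 *
          ((-(1 / 2 * (9 / 25)) + -(1 / 2 * (3 / 5)) * w) * exp (5 / 3 * (1 - w))))
        (fun w => 1 / 2 * (1 - ν / 2) * 1 + ν / 2 *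
          ((-(1 / 2 * (3 / 5)) - 5 / 3 * -(1 / 2 * (9 / 25)) - 5 / 3 * -(1 / 2 * (3 / 5)) * w)
          * exp (5 / 3 * (1 - w))))
        (Continuous.continuousOn (by fun_prop))
        (fun w _ => ((hasDerivAt_id w).const_mul _).add ((dpsi _ _ _ _).const_mul _)) (fun w hw => by
          have hw0 := hw.1
          have hw1 := hw.2
          have e2 : w ^ (ν / 2) * exp (t * (1 - w) / 2) ≤ 1 - ν / 2 + ν / 2 * (w * exp (5 / 3 * (1 - w))) := by
            calc w ^ (ν / 2) * exp (t * (1 - w) / 2)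
                ≤ w ^ (ν / 2) * exp (5 / 3 * (1 - w) * (ν / 2)) := by
                  refine mul_le_mul_of_nonneg_left (exp_le_exp.2 ?_) (Real.rpow_nonneg hw0.le _)
                  nlinarith
              _ = (1 + (w * exp (5 / 3 * (1 - w)) - 1)) ^ (ν / 2) := by
                  rw [exp_mul, ← Real.mul_rpow hw0.le (exp_pos _).le]; congr 1; ring
              _ ≤ 1 + (ν / 2) * (w * exp (5 / 3 * (1 - w)) - 1) :=
                  rpow_one_add_le_one_add_mul_self (by
                    have : 0 ≤ w * exp (5 / 3 * (1 - w)) := by positivity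
                    linarith) hθ0.le hθ1
              _ = _ := by ring
          rw [hexp]
          linarith)
      norm_num at this ⊢
      nlinarith
    · refine le_trans ?_ (le_max_right _ _)
      set κ := 5 / 3 * (ν / 2) with hκ
      have hκ0 : 0 < κ := by positivity
      have := lemR2 (ν + 2) t 2 y y' g hd hode hg htp hlim
        (fun w => (1 / 2 * (3 / 5 / (ν / 2) + 9 / 25 / (ν / 2) - 3 / 5) + 1 / 2 * (3 / 5) * w) * exp (κ * (1 - w)))
        (fun w => ((1 / 2 * (3 / 5)) - κ * (1 / 2 * (3 / 5 / (ν / 2) + 9 / 25 / (ν / 2) - 3 / 5))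
          - κ * (1 / 2 * (3 / 5)) * w) * exp (κ * (1 - w)))
        (fun w hw => by
          have hw' : 1 ≤ w := hw
          refine mul_nonneg ?_ (exp_pos _).le
          have : 0 ≤ 3 / 5 / (ν / 2) + 9 / 25 / (ν / 2) := by positivity
          linarith) (fun w _ => dpsi _ _ _ _) (fun w hw => by
          have hw1 : 1 ≤ w := hw
          have hw0 : 0 < w := by linarith
          have e1 : w ^ (ν / 2) ≤ 1 + ν / 2 * (w - 1) := by
            have := rpow_one_add_le_one_add_mul_self (s := w - 1) (by linarith) hθ0.le hθ1
            rwa [add_sub_cancel] at this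
          have e2 : w ^ (ν / 2) * exp (t * (1 - w) / 2) ≤ (1 + ν / 2 * (w - 1)) * exp (κ * (1 - w)) := by
            refine mul_le_mul e1 (exp_le_exp.2 ?_) (exp_pos _).le (by nlinarith)
            rw [hκ]; nlinarith
          rw [hexp]
          have e3 : -((1 / 2 * (3 / 5) - κ * (1 / 2 * (3 / 5 / (ν / 2) + 9 / 25 / (ν / 2) - 3 / 5))
            - κ * (1 / 2 * (3 / 5)) * w) * exp (κ * (1 - w)))
            = 1 / 2 * ((1 + ν / 2 * (w - 1)) * exp (κ * (1 - w))) := by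
            rw [hκ]; field_simp; ring
          rw [e3]; linarith)
      refine this.trans ?_
      simp only [sub_self, mul_zero, exp_zero, mul_one]
      have : 2 * (1 / 2 * (3 / 5 / (ν / 2) + 9 / 25 / (ν / 2) - 3 / 5) + 1 / 2 * (3 / 5))
        = 24 / 25 * (2 / ν) := by field_simp; ring
      rw [this]
      have : 0 < 2 / ν := by positivity
      linarith

/-- The main analytic statement on the Stein equation, in the shifted variable. -/
theorem stein_main (ν : ℝ) (hν : 0 < ν) (k k1 k2 : ℝ → ℝ) (hk : ∀ t, HasDerivAt k (k1 t) t)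
    (hk1 : ∀ t, HasDerivAt k1 (k2 t) t) (hk2 : Continuous k2) (b1 : ∀ t, |k1 t| ≤ 1)
    (b2 : ∀ t, |k2 t| ≤ 1)
    (h0 : ∫ s in Set.Ioi 0, s ^ (ν / 2 - 1) * exp (-s) * k (2 * s) = 0) :
    ∃ f f1 : ℝ → ℝ, (∀ t, HasDerivAt f (f1 t) t) ∧ (∀ t, |f t| ≤ 1) ∧
      (∀ t, |f1 t| ≤ max 1 (2 / ν)) ∧
      (∀ x y, |f1 x - f1 y| ≤ (1 + 2 * max 1 (2 / ν)) / (2 + ν / 2) * |x - y|) ∧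
      ∀ t, 2 * t * f1 t + (ν - t) * f t = k t := by
  obtain ⟨f, f1, f2, hf, hf1, hf2, hode⟩ := stein_exists ν hν k k1 k2 hk hk1 hk2
  have hkc : Continuous k := continuous_iff_continuousAt.2 fun t => (hk t).continuousAt
  have hf1c : Continuous f1 := continuous_iff_continuousAt.2 fun t => (hf1 t).continuousAt
  set m := max 1 (2 / ν) with hm
  have hm1 : 1 ≤ m := le_max_left _ _
  have hkl : ∀ x y, |k x - k y| ≤ |x - y| := by
    intro x y
    have := Convex.norm_image_sub_le_of_norm_hasDerivWithin_le (f := k) (f' := k1) (C := 1)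
      (s := Set.univ) (x := y) (y := x)
      (fun t _ => (hk t).hasDerivWithinAt) (fun t _ => b1 t) convex_univ (Set.mem_univ _) (Set.mem_univ _)
    simpa using this
  have fb := stein_f_bound ν hν k f f1 hf hkl hkc hode h0
  -- differentiated equation
  have ode1 : ∀ t, 2 * t * f2 t + ((ν + 2) - t) * f1 t = k1 t + f t := by
    intro t
    have h1 : HasDerivAt k (2 * 1 * f1 t + 2 * t * f2 t + ((0 - 1) * f t + (ν - t) * f1 t)) t := by
      have := ((((hasDerivAt_id t).const_mul 2).mul (hf1 t)).add
        (((hasDerivAt_const t ν).sub (hasDerivAt_id t)).mul (hf t)))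
      refine (this.congr_of_eventuallyEq (Filter.Eventually.of_forall fun s => ?_))
      simp only [Pi.add_apply, Pi.mul_apply, Pi.sub_apply, id]
      exact (hode s).symm
    have := h1.unique (hk t)
    linarith
  have g1b : ∀ s, |k1 s + f s| ≤ 2 := fun s => by
    have := abs_add_le (k1 s) (f s)
    linarith [b1 s, fb s]
  have hlim : Filter.Tendsto (fun s => s ^ ((ν + 2) / 2) * exp (-s / 2) * f1 s) Filter.atTop (nhds 0) := by
    have h1 := (tendsto_rpow_mul_exp_neg_mul_atTop_nhds_zero ((ν + 2) / 2) (1 / 2) (by norm_num)).mul_const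
      (|k 0| + ν + 1)
    rw [zero_mul] at h1
    refine squeeze_zero_norm' ?_ h1
    filter_upwards [Filter.eventually_ge_atTop 1] with s hs
    have hs0 : 0 < s := by linarith
    have hp : 0 ≤ s ^ ((ν + 2) / 2) * exp (-s / 2) := by
      have := Real.rpow_nonneg hs0.le ((ν + 2) / 2)
      positivity
    rw [norm_mul, Real.norm_of_nonneg hp, show -(1 / 2) * s = -s / 2 by ring, Real.norm_eq_abs]
    refine mul_le_mul_of_nonneg_left ?_ hp
    have e1 : 2 * s * f1 s = k s - (ν - s) * f s := by linarith [hode s]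
    have e2 : |k s| ≤ |k 0| + s := by
      have h1 := hkl s 0
      rw [sub_zero, abs_of_pos hs0] at h1
      have h2 := abs_add_le (k s - k 0) (k 0)
      rw [sub_add_cancel] at h2
      linarith
    have e3 : |(ν - s) * f s| ≤ ν + s := by
      rw [abs_mul]
      have : |ν - s| ≤ ν + s := by rw [abs_le]; constructor <;> linarith
      nlinarith [fb s, abs_nonneg (f s), abs_nonneg (ν - s)]
    have e4 : 2 * s * |f1 s| ≤ |k 0| + s + (ν + s) := by
      rw [← abs_of_pos (by linarith : 0 < 2 * s), ← abs_mul, e1]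
      have := abs_sub (k s) ((ν - s) * f s)
      linarith
    have h5 : 0 ≤ |k 0| := abs_nonneg _
    by_contra hcon
    push Not at hcon
    nlinarith
  have f1b' : ∀ t, t ≠ 0 → |f1 t| ≤ m := fun t ht =>
    stein_f1_bound ν hν f1 f2 (fun s => k1 s + f s) hf1c (fun s _ => hf1 s) (fun s _ => ode1 s) g1b hlim t ht
  have f1b : ∀ t, |f1 t| ≤ m := by
    intro t
    by_cases ht : t = 0
    · subst ht
      have h1 := ode1 0
      have h2 := g1b 0
      rw [← h1] at h2
      simp only [mul_zero, zero_mul, zero_add, sub_zero, abs_mul] at h2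
      rw [abs_of_pos (by linarith : 0 < ν + 2)] at h2
      nlinarith [abs_nonneg (f1 0)]
    · exact f1b' t ht
  set M := (1 + 2 * m) / (2 + ν / 2) with hM
  have f2b' : ∀ t, t ≠ 0 → |f2 t| ≤ M := by
    intro t ht
    rcases le_total t (2 + ν / 2) with hl | hr
    · refine lemL3 (ν + 4) t (1 + 2 * m) (by linarith) f2
        (fun t => (k2 t + 2 * f1 t - (ν + 4 - t) * f2 t) / (2 * t)) (fun t => k2 t + 2 * f1 t) hf2 ?_ ?_ ?_ ht
        (2 + ν / 2) (by linarith) (by linarith) (by linarith)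
      · intro s hs
        have hs2 : (2 * s) ≠ 0 := mul_ne_zero two_ne_zero hs
        have e : f2 =ᶠ[nhds s] fun s => (k1 s + f s - ((ν + 2) - s) * f1 s) / (2 * s) := by
          filter_upwards [isOpen_ne.mem_nhds hs] with x hx
          have hx' : x ≠ 0 := hx
          rw [← ode1 x]; field_simp; ring
        have hd : HasDerivAt (fun s => (k1 s + f s - ((ν + 2) - s) * f1 s) / (2 * s))
            (((k2 s + f1 s - ((0 - 1) * f1 s + ((ν + 2) - s) * f2 s)) * (2 * s)
              - (k1 s + f s - ((ν + 2) - s) * f1 s) * (2 * 1)) / (2 * s) ^ 2) s :=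
          (((hk1 s).add (hf s)).sub (((hasDerivAt_const s (ν + 2)).sub (hasDerivAt_id s)).mul (hf1 s))).div
            ((hasDerivAt_id s).const_mul 2) hs2
        refine (hd.congr_of_eventuallyEq e).congr_deriv ?_
        rw [← ode1 s]; field_simp; ring
      · intro s hs
        field_simp; ring
      · intro s
        have := abs_add_le (k2 s) (2 * f1 s)
        rw [abs_mul, abs_two] at this
        linarith [b2 s, f1b s]
    · have htp : 0 < t := by linarith
      have hA : |((ν + 2) - t) * f1 t| ≤ 2 := by
        rcases lt_trichotomy t (ν + 2) with h | h | h
        · have := lemL3 (ν + 2) t 2 (by linarith) f1 f2 (fun s => k1 s + f s) hf1c (fun s _ => hf1 s)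
            (fun s _ => ode1 s) g1b ht (ν + 2 - t) (by linarith) (by linarith) le_rfl
          rw [le_div_iff₀ (by linarith)] at this
          rw [abs_mul, abs_of_pos (by linarith : 0 < ν + 2 - t)]
          linarith
        · rw [h]; simp
        · have := lemR3 (ν + 2) t 2 f1 f2 (fun s => k1 s + f s) (fun s _ => hf1 s)
            (fun s _ => ode1 s) g1b htp hlim h
          rw [le_div_iff₀ (by linarith)] at this
          rw [abs_mul, abs_of_neg (by linarith : ν + 2 - t < 0)]
          linarith
      have h3 : |2 * t * f2 t| ≤ 4 := by
        have e : 2 * t * f2 t = (k1 t + f t) - ((ν + 2) - t) * f1 t := by linarith [ode1 t]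
        rw [e]
        have := abs_sub (k1 t + f t) (((ν + 2) - t) * f1 t)
        linarith [g1b t]
      rw [abs_mul, abs_of_pos (by linarith : 0 < 2 * t)] at h3
      rw [hM, le_div_iff₀ (by linarith)]
      nlinarith [abs_nonneg (f2 t)]
  have f2b : ∀ t, |f2 t| ≤ M := by
    intro t
    have hcl : IsClosed {t | |f2 t| ≤ M} := isClosed_le (by fun_prop) continuous_const
    have hdense : Dense {t : ℝ | t ≠ 0} := dense_compl_singleton 0
    have := hcl.closure_subset_iff.2 (fun t (ht : t ∈ {t : ℝ | t ≠ 0}) => f2b' t ht)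
    exact this (hdense t)
  refine ⟨f, f1, hf, fb, f1b, ?_, hode⟩
  intro x y
  have := Convex.norm_image_sub_le_of_norm_hasDerivWithin_le (f := f1) (f' := f2) (C := M)
    (s := Set.univ) (x := y) (y := x)
    (fun t _ => (hf1 t).hasDerivWithinAt) (fun t _ => f2b t) convex_univ (Set.mem_univ _) (Set.mem_univ _)
  simpa using this
end DJ

namespace DJ

lemma cgl_integral (ν : ℝ) (hν : 0 < ν) (h : ℝ → ℝ) (hc : Continuous h) :
    ∫ x, h x ∂(centeredGammaLaw ν)
      = (1 / Gamma (ν / 2)) * ∫ s in Set.Ioi 0, s ^ (ν / 2 - 1) * exp (-s) * h (2 * s - ν) := by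
  have hθ : 0 < ν / 2 := by positivity
  unfold centeredGammaLaw
  rw [integral_map (by fun_prop) hc.aestronglyMeasurable, gammaMeasure,
    integral_withDensity_eq_integral_toReal_smul
      (f := gammaPDF (ν / 2) 1) ((measurable_gammaPDFReal _ _).ennreal_ofReal) (Filter.Eventually.of_forall fun x => ENNReal.ofReal_lt_top),
    ← integral_const_mul, ← integral_indicator measurableSet_Ioi]
  refine integral_congr_ae ?_
  have : ∀ᵐ x : ℝ, x ≠ 0 := by
    simp [ae_iff, measure_singleton]
  filter_upwards [this] with x hx
  rw [gammaPDF, ENNReal.toReal_ofReal (gammaPDFReal_nonneg hθ one_pos x), gammaPDFReal]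
  rcases lt_or_gt_of_ne hx with h0 | h0
  · rw [if_neg (not_le.2 h0), Set.indicator_of_notMem (by simpa using h0.le), zero_smul]
  · rw [if_pos h0.le, Set.indicator_of_mem (by simpa using h0), Real.one_rpow, smul_eq_mul, one_mul]
    ring

lemma cgl_prob (ν : ℝ) (hν : 0 < ν) : IsProbabilityMeasure (centeredGammaLaw ν) := by
  have := isProbabilityMeasure_gammaMeasure (by positivity : 0 < ν / 2) one_pos
  exact Measure.isProbabilityMeasure_map (by fun_prop)

lemma cgl_integrable (ν : ℝ) (hν : 0 < ν) : Integrable (fun x : ℝ => x) (centeredGammaLaw ν) := by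
  have hθ : 0 < ν / 2 := by positivity
  unfold centeredGammaLaw
  rw [integrable_map_measure (by fun_prop) (by fun_prop), gammaMeasure,
    integrable_withDensity_iff_integrable_smul'
      (f := gammaPDF (ν / 2) 1) ((measurable_gammaPDFReal _ _).ennreal_ofReal) (Filter.Eventually.of_forall fun x => ENNReal.ofReal_lt_top)]
  have h1 := (gamma_int (ν / 2) hθ (fun s => 2 * s - ν) (by fun_prop) ν 2 fun s hs => by
    rw [abs_le]; constructor <;> linarith).const_mul (1 / Gamma (ν / 2))
  replace h1 := (integrable_indicator_iff measurableSet_Ioi).2 h1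
  refine h1.congr ?_
  have : ∀ᵐ x : ℝ, x ≠ 0 := by
    simp [ae_iff, measure_singleton]
  filter_upwards [this] with x hx
  rw [gammaPDF, ENNReal.toReal_ofReal (gammaPDFReal_nonneg hθ one_pos x), gammaPDFReal]
  rcases lt_or_gt_of_ne hx with h0 | h0
  · rw [if_neg (not_le.2 h0), Set.indicator_of_notMem (by simpa using h0.le), zero_smul]
  · rw [if_pos h0.le, Set.indicator_of_mem (by simpa using h0), Real.one_rpow, smul_eq_mul, one_mul]
    simp only [Function.comp]
    ring

/-- Stein equation for the centered Gamma law. -/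
theorem stein_eq (ν : ℝ) (hν : 0 < ν) (h h1 h2 : ℝ → ℝ) (hh : ∀ t, HasDerivAt h (h1 t) t)
    (hh1 : ∀ t, HasDerivAt h1 (h2 t) t) (hh2 : Continuous h2) (b1 : ∀ t, |h1 t| ≤ 1)
    (b2 : ∀ t, |h2 t| ≤ 1) :
    ∃ f f1 : ℝ → ℝ, (∀ t, HasDerivAt f (f1 t) t) ∧ (∀ t, |f t| ≤ 1) ∧
      (∀ t, |f1 t| ≤ max 1 (2 / ν)) ∧
      (∀ x y, |f1 x - f1 y| ≤ (1 + 2 * max 1 (2 / ν)) / (2 + ν / 2) * |x - y|) ∧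
      ∀ x, 2 * (x + ν) * f1 x - x * f x = h x - ∫ z, h z ∂(centeredGammaLaw ν) := by
  have hθ : 0 < ν / 2 := by positivity
  have hc : Continuous h := continuous_iff_continuousAt.2 fun t => (hh t).continuousAt
  have hl : ∀ x y, |h x - h y| ≤ |x - y| := by
    intro x y
    have := Convex.norm_image_sub_le_of_norm_hasDerivWithin_le (f := h) (f' := h1) (C := 1)
      (s := Set.univ) (x := y) (y := x)
      (fun t _ => (hh t).hasDerivWithinAt) (fun t _ => b1 t) convex_univ (Set.mem_univ _) (Set.mem_univ _)
    simpa using this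
  set c := ∫ z, h z ∂(centeredGammaLaw ν) with hcdef
  have hsh : ∀ t : ℝ, HasDerivAt (fun t => t - ν) 1 t := fun t => (hasDerivAt_id t).sub_const ν
  have hki : IntegrableOn (fun s => s ^ (ν / 2 - 1) * exp (-s) * h (2 * s - ν)) (Set.Ioi 0) := by
    refine gamma_int (ν / 2) hθ (fun s => h (2 * s - ν)) (by fun_prop) (|h 0| + ν) 2 fun s hs => ?_
    have h1 := hl (2 * s - ν) 0
    have h3 : |2 * s - ν| ≤ 2 * s + ν := by rw [abs_le]; constructor <;> linarith
    rw [sub_zero] at h1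
    have h2 := abs_add_le (h (2 * s - ν) - h 0) (h 0)
    rw [sub_add_cancel] at h2
    linarith
  have hci : IntegrableOn (fun s => s ^ (ν / 2 - 1) * exp (-s) * c) (Set.Ioi 0) :=
    gamma_int (ν / 2) hθ (fun s => c) (by fun_prop) |c| 0 fun s hs => by simp
  have hG := (Real.Gamma_pos_of_pos hθ).ne'
  obtain ⟨f, f1, hf, fb, f1b, f1l, ode⟩ := stein_main ν hν (fun t => h (t - ν) - c) (fun t => h1 (t - ν))
    (fun t => h2 (t - ν))
    (fun t => by
      have := ((hh (t - ν)).comp t (hsh t)).sub_const c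
      simpa using this)
    (fun t => by
      have := ((hh1 (t - ν)).comp t (hsh t))
      rw [mul_one] at this
      exact this) (by fun_prop) (fun t => b1 _) (fun t => b2 _) (by
      have e := integral_sub hki hci
      have e2 : ∫ s in Set.Ioi 0, s ^ (ν / 2 - 1) * exp (-s) * c = Gamma (ν / 2) * c := by
        rw [integral_mul_const, Real.Gamma_eq_integral hθ]
        simp_rw [mul_comm]
      have e3 := cgl_integral ν hν h hc
      rw [← hcdef] at e3
      have e4 : ∫ s in Set.Ioi 0, s ^ (ν / 2 - 1) * exp (-s) * h (2 * s - ν) = Gamma (ν / 2) * c := by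
        rw [e3]; field_simp
      rw [e2, e4, sub_self] at e
      refine Eq.trans ?_ e
      refine integral_congr_ae (Filter.Eventually.of_forall fun s => ?_)
      simp only; ring)
  refine ⟨fun x => f (x + ν), fun x => f1 (x + ν), fun t => ?_, fun t => fb _, fun t => f1b _,
    fun x y => ?_, fun x => ?_⟩
  · have := (hf (t + ν)).comp t ((hasDerivAt_id t).add_const ν)
    rw [mul_one] at this
    exact this
  · have := f1l (x + ν) (y + ν)
    rwa [add_sub_add_right_eq_sub] at this
  · have := ode (x + ν)
    simp only [add_sub_cancel_right] at this
    linarith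

lemma lip_integrable (P : Measure ℝ) [IsProbabilityMeasure P] (hP : Integrable (fun x : ℝ => x) P)
    (h : ℝ → ℝ) (hc : Continuous h) (hl : ∀ x y, |h x - h y| ≤ |x - y|) : Integrable h P := by
  refine Integrable.mono' ((integrable_const |h 0|).add hP.abs) hc.aestronglyMeasurable
    (Filter.Eventually.of_forall fun x => ?_)
  have h1 := hl x 0
  rw [sub_zero] at h1
  have h2 := abs_add_le (h x - h 0) (h 0)
  rw [sub_add_cancel] at h2
  simp only [Pi.add_apply, Real.norm_eq_abs]
  linarith

/-- Reduction to twice continuously differentiable test functions. -/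
theorem reduceC2 (P Q : Measure ℝ) [IsProbabilityMeasure P] [IsProbabilityMeasure Q]
    (hP : Integrable (fun x : ℝ => x) P) (hQ : Integrable (fun x : ℝ => x) Q) (B : ℝ)
    (H : ∀ h h1 h2 : ℝ → ℝ, (∀ t, HasDerivAt h (h1 t) t) → (∀ t, HasDerivAt h1 (h2 t) t) →
      Continuous h2 → (∀ t, |h1 t| ≤ 1) → (∀ t, |h2 t| ≤ 1) →
      |(∫ x, h x ∂P) - ∫ x, h x ∂Q| ≤ B) (h : ℝ → ℝ) (hh : MemH2 h) :
    |(∫ x, h x ∂P) - ∫ x, h x ∂Q| ≤ B := by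
  obtain ⟨hd, hlip, hlip1⟩ := hh
  have hc : Continuous h := hd.continuous
  have hc1 : Continuous (deriv h) := hlip1.continuous
  have hl : ∀ x y, |h x - h y| ≤ |x - y| := fun x y => by
    have := hlip.dist_le_mul x y
    simpa [Real.dist_eq] using this
  have hl1 : ∀ x y, |deriv h x - deriv h y| ≤ |x - y| := fun x y => by
    have := hlip1.dist_le_mul x y
    simpa [Real.dist_eq] using this
  have hPi := lip_integrable P hP h hc hl
  have hQi := lip_integrable Q hQ h hc hl
  refine le_of_forall_pos_le_add fun δ hδ => ?_
  set ε := δ / 2 with hε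
  have hε0 : 0 < ε := by positivity
  have dshift : ∀ x : ℝ, HasDerivAt (fun x => x + ε) 1 x := fun x => (hasDerivAt_id x).add_const ε
  set A : ℝ → ℝ := fun x => ∫ s in (0:ℝ)..x, h s with hA
  have dA : ∀ x, HasDerivAt A (h x) x := fun x => hc.integral_hasStrictDerivAt 0 x |>.hasDerivAt
  set g : ℝ → ℝ := fun x => (A (x + ε) - A x) / ε with hg
  set g1 : ℝ → ℝ := fun x => (h (x + ε) - h x) / ε with hg1
  set g2 : ℝ → ℝ := fun x => (deriv h (x + ε) - deriv h x) / ε with hg2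
  have dg : ∀ x, HasDerivAt g (g1 x) x := fun x => by
    have := (((dA (x + ε)).comp x (dshift x)).sub (dA x)).div_const ε
    simpa using this
  have dg1 : ∀ x, HasDerivAt g1 (g2 x) x := fun x => by
    have := ((((hd (x + ε)).hasDerivAt).comp x (dshift x)).sub (hd x).hasDerivAt).div_const ε
    simpa using this
  have hb1 : ∀ x, |g1 x| ≤ 1 := fun x => by
    simp only [hg1]
    rw [abs_div, abs_of_pos hε0, div_le_one hε0]
    have := hl (x + ε) x
    rwa [add_sub_cancel_left, abs_of_pos hε0] at this
  have hb2 : ∀ x, |g2 x| ≤ 1 := fun x => by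
    simp only [hg2]
    rw [abs_div, abs_of_pos hε0, div_le_one hε0]
    have := hl1 (x + ε) x
    rwa [add_sub_cancel_left, abs_of_pos hε0] at this
  have hmain := H g g1 g2 dg dg1 (by simp only [hg2]; fun_prop) hb1 hb2
  have hgc : Continuous g := continuous_iff_continuousAt.2 fun t => (dg t).continuousAt
  have hgl : ∀ x y, |g x - g y| ≤ |x - y| := by
    intro x y
    have := Convex.norm_image_sub_le_of_norm_hasDerivWithin_le (f := g) (f' := g1) (C := 1)
      (s := Set.univ) (x := y) (y := x)
      (fun t _ => (dg t).hasDerivWithinAt) (fun t _ => hb1 t) convex_univ (Set.mem_univ _) (Set.mem_univ _)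
    simpa using this
  have hgP := lip_integrable P hP g hgc hgl
  have hgQ := lip_integrable Q hQ g hgc hgl
  have hclose : ∀ x, |h x - g x| ≤ ε := by
    intro x
    have e1 : A (x + ε) - A x = ∫ s in x..(x + ε), h s :=
      intervalIntegral.integral_interval_sub_left (hc.intervalIntegrable _ _) (hc.intervalIntegrable _ _)
    have e2 : h x - g x = (∫ s in x..(x + ε), (h x - h s)) / ε := by
      rw [intervalIntegral.integral_sub (by simp) (hc.intervalIntegrable _ _), ← e1]
      simp only [hg, intervalIntegral.integral_const, add_sub_cancel_left, smul_eq_mul]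
      field_simp
    rw [e2, abs_div, abs_of_pos hε0, div_le_iff₀ hε0]
    have := intervalIntegral.norm_integral_le_of_norm_le_const (a := x) (b := x + ε) (C := ε)
      (f := fun s => h x - h s) (fun s hs => by
        rw [Set.uIoc_of_le (by linarith)] at hs
        refine (hl x s).trans ?_
        rw [abs_le]; constructor <;> linarith [hs.1, hs.2])
    simpa [abs_of_pos hε0] using this
  have hav : ∀ ρ : Measure ℝ, IsProbabilityMeasure ρ → Integrable h ρ → Integrable g ρ →
      |(∫ x, h x ∂ρ) - ∫ x, g x ∂ρ| ≤ ε := by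
    intro ρ _ h1 h2
    rw [← integral_sub h1 h2]
    have := norm_integral_le_of_norm_le_const (μ := ρ) (f := fun x => h x - g x) (C := ε)
      (Filter.Eventually.of_forall hclose)
    simpa using this
  have q1 := abs_le.1 (hav P inferInstance hPi hgP)
  have q2 := abs_le.1 (hav Q inferInstance hQi hgQ)
  have q3 := abs_le.1 hmain
  rw [abs_le]
  constructor <;> linarith

end DJ

namespace DJ

section hilb
variable {H : Type*} [NormedAddCommGroup H] [InnerProductSpace ℝ H] {ι : Type*} [DecidableEq ι]

/-- Vectors depending on few coordinates. -/
def gen (P : ι → H →ₗ[ℝ] H) (S : Finset ι) (r : ℝ) : Set H :=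
  {y | ∃ K : Finset ι, ((K ∩ S).card : ℝ) ≤ r ∧ ∀ i ∈ S, i ∉ K → P i y = y}

lemma span_P {P : ι → H →ₗ[ℝ] H} (hcomm : ∀ i j x, P i (P j x) = P j (P i x))
    (S : Finset ι) (r : ℝ) (i : ι) {Y : H} (hY : Y ∈ Submodule.span ℝ (gen P S r)) :
    P i Y ∈ Submodule.span ℝ (gen P S r) := by
  induction hY using Submodule.span_induction with
  | mem y hy =>
    obtain ⟨K, hK, h⟩ := hy
    exact Submodule.subset_span ⟨K, hK, fun j hj hjK => by rw [hcomm, h j hj hjK]⟩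
  | zero => simp
  | add x y _ _ hx hy => rw [map_add]; exact Submodule.add_mem _ hx hy
  | smul a x _ hx => rw [map_smul]; exact Submodule.smul_mem _ _ hx

lemma span_mono (P : ι → H →ₗ[ℝ] H) (S : Finset ι) (r : ℝ) (i : ι) {Y : H}
    (hY : Y ∈ Submodule.span ℝ (gen P (insert i S) r)) : Y ∈ Submodule.span ℝ (gen P S r) := by
  refine Submodule.span_mono ?_ hY
  rintro y ⟨K, hK, h⟩
  refine ⟨K, le_trans ?_ hK, fun j hj => h j (Finset.mem_insert_of_mem hj)⟩
  exact_mod_cast Finset.card_le_card (Finset.inter_subset_inter_left (Finset.subset_insert _ _))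

lemma span_Q {P : ι → H →ₗ[ℝ] H} (hcomm : ∀ i j x, P i (P j x) = P j (P i x))
    (S : Finset ι) (r : ℝ) (i : ι) (hi : i ∉ S) {Y : H}
    (hY : Y ∈ Submodule.span ℝ (gen P (insert i S) r)) :
    Y - P i Y ∈ Submodule.span ℝ (gen P S (r - 1)) := by
  induction hY using Submodule.span_induction with
  | mem y hy =>
    obtain ⟨K, hK, h⟩ := hy
    by_cases hiK : i ∈ K
    · refine Submodule.subset_span ⟨K, ?_, fun j hj hjK => ?_⟩
      · have : (K ∩ insert i S).card = (K ∩ S).card + 1 := by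
          rw [Finset.inter_insert_of_mem hiK, Finset.card_insert_of_notMem (by simp [hi])]
        rw [this] at hK
        push_cast at hK; linarith
      · rw [map_sub, hcomm, h j (Finset.mem_insert_of_mem hj) hjK]
    · rw [h i (Finset.mem_insert_self _ _) hiK, sub_self]; exact Submodule.zero_mem _
  | zero => simp
  | add x y _ _ hx hy =>
    rw [map_add, add_sub_add_comm]; exact Submodule.add_mem _ hx hy
  | smul a x _ hx => rw [map_smul, ← smul_sub]; exact Submodule.smul_mem _ _ hx

lemma pyth {P : ι → H →ₗ[ℝ] H}
    (hsym : ∀ i x y, inner ℝ (P i x) y = inner ℝ x (P i y))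
    (hid : ∀ i x, P i (P i x) = P i x)
    (i : ι) (Y : H) : ‖Y‖ ^ 2 = ‖P i Y‖ ^ 2 + ‖Y - P i Y‖ ^ 2 := by
  have h : inner ℝ (P i Y) (Y - P i Y) = 0 := by
    rw [inner_sub_right, ← hsym, hid, hsym, ← hsym, sub_self]
  have := norm_add_sq_real (P i Y) (Y - P i Y)
  rw [h] at this
  simpa using this

lemma hilb1 {P : ι → H →ₗ[ℝ] H}
    (hsym : ∀ i x y, inner ℝ (P i x) y = inner ℝ x (P i y))
    (hid : ∀ i x, P i (P i x) = P i x)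
    (hcomm : ∀ i j x, P i (P j x) = P j (P i x))
    (S : Finset ι) : ∀ (r : ℝ) (Y : H), Y ∈ Submodule.span ℝ (gen P S r) →
    ∑ i ∈ S, ‖Y - P i Y‖ ^ 2 ≤ r * ‖Y‖ ^ 2 := by
  induction S using Finset.induction_on with
  | empty =>
    intro r Y hY
    by_cases hr : 0 ≤ r
    · simp; positivity
    · have : gen P ∅ r = ∅ := by
        ext y
        simp only [gen, Finset.inter_empty, Finset.card_empty, Nat.cast_zero]
        constructor
        · rintro ⟨K, hK, _⟩; exact absurd hK hr
        · rintro ⟨⟩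
      rw [this] at hY
      simp at hY
      simp [hY]
  | insert i S hi ih =>
    intro r Y hY
    have h1 := ih r (P i Y) (span_P hcomm _ _ _ (span_mono P S r i hY))
    have h2 := ih (r - 1) (Y - P i Y) (span_Q hcomm S r i hi hY)
    rw [Finset.sum_insert hi]
    have h3 : ∀ j ∈ S, ‖Y - P j Y‖ ^ 2 = ‖P i Y - P j (P i Y)‖ ^ 2
        + ‖(Y - P i Y) - P j (Y - P i Y)‖ ^ 2 := by
      intro j _
      rw [pyth hsym hid i (Y - P j Y)]
      congr 3
      · rw [map_sub, hcomm]
      · rw [map_sub, map_sub, hcomm j i]; abel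
    rw [Finset.sum_congr rfl h3, Finset.sum_add_distrib]
    have h4 : r * ‖Y‖ ^ 2 = r * ‖P i Y‖ ^ 2 + r * ‖Y - P i Y‖ ^ 2 := by
      rw [pyth hsym hid i Y]; ring
    rw [sub_mul] at h2
    linarith

lemma hilb2 {P : ι → H →ₗ[ℝ] H}
    (hsym : ∀ i x y, inner ℝ (P i x) y = inner ℝ x (P i y))
    (hid : ∀ i x, P i (P i x) = P i x)
    (hcomm : ∀ i j x, P i (P j x) = P j (P i x))
    (S : Finset ι) (r : ℝ) (hr : 0 < r) (V : H) (hV : V ∈ Submodule.span ℝ (gen P S r)) :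
    ‖V - (1 / r) • ∑ i ∈ S, (V - P i V)‖ ^ 2
      ≤ inner ℝ V (V - (1 / r) • ∑ i ∈ S, (V - P i V)) := by
  have key : 0 ≤ inner ℝ (∑ i ∈ S, (V - P i V)) (r • V - ∑ j ∈ S, (V - P j V)) := by
    rw [sum_inner]
    refine Finset.sum_nonneg fun i _ => ?_
    have hQ : V - P i V ∈ Submodule.span ℝ (gen P S r) :=
      Submodule.sub_mem _ hV (span_P hcomm _ _ _ hV)
    have h1 := hilb1 hsym hid hcomm S r _ hQ
    have hq : ∀ x y : H, inner ℝ (x - P i x) (y) = inner ℝ (x - P i x) (y - P i y) := by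
      intro x y
      have : inner ℝ (x - P i x) (P i y) = 0 := by
        rw [inner_sub_left, hsym, hid, sub_self]
      rw [inner_sub_right _ y, this, sub_zero]
    have hself : ∀ j (x : H), inner ℝ x (x - P j x) = ‖x - P j x‖ ^ 2 := by
      intro j x
      rw [← real_inner_self_eq_norm_sq]
      have : inner ℝ (P j x) (x - P j x) = 0 := by
        rw [inner_sub_right, ← hsym, hid, hsym, ← hsym, sub_self]
      rw [inner_sub_left x, this, sub_zero]
    rw [inner_sub_right, real_inner_smul_right, inner_sum]
    have h2 : ∀ j ∈ S, inner ℝ (V - P i V) (V - P j V) =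
        ‖(V - P i V) - P j (V - P i V)‖ ^ 2 := by
      intro j _
      rw [hq, ← hself j]
      congr 1
      rw [map_sub, map_sub, hcomm j i]; abel
    rw [Finset.sum_congr rfl h2, hq, real_inner_self_eq_norm_sq]
    linarith
  set N := ∑ i ∈ S, (V - P i V)
  have e : inner ℝ V (V - (1 / r) • N) - ‖V - (1 / r) • N‖ ^ 2
      = (1 / r) ^ 2 * inner ℝ N (r • V - N) := by
    rw [← real_inner_self_eq_norm_sq]
    simp only [inner_sub_left, inner_sub_right, real_inner_smul_left, real_inner_smul_right]
    rw [real_inner_comm N V]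
    field_simp
    ring
  have : 0 ≤ (1 / r) ^ 2 * inner ℝ N (r • V - N) := by positivity
  linarith

end hilb

section cond
lemma setInt_indep {Ω : Type*} {m₁ m₂ : MeasurableSpace Ω} [mΩ : MeasurableSpace Ω] {μ : Measure Ω} [IsProbabilityMeasure μ]
    (h1 : m₁ ≤ mΩ) (h2 : m₂ ≤ mΩ)
    (hind : Indep m₁ m₂ μ) {G : Ω → ℝ} (hG : StronglyMeasurable[m₁] G) (hGi : Integrable G μ)
    {A B : Set Ω} (hA : MeasurableSet[m₁] A) (hB : MeasurableSet[m₂] B) :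
    ∫ ω in A ∩ B, G ω ∂μ = μ.real B * ∫ ω in A, G ω ∂μ := by
  have hsm : StronglyMeasurable[m₁] (A.indicator G) := hG.indicator hA
  have hc := condExp_indep_eq h1 h2 hsm hind
  have e1 : ∫ ω in A ∩ B, G ω ∂μ = ∫ ω in B, A.indicator G ω ∂μ := by
    rw [setIntegral_indicator (h1 _ hA), Set.inter_comm]
  rw [e1, ← setIntegral_condExp h2 (hGi.indicator (h1 _ hA)) hB,
    setIntegral_congr_ae (g := fun _ => ∫ ω in A, G ω ∂μ) (h2 _ hB)]
  · simp
  · filter_upwards [hc] with ω h _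
    rw [h, integral_indicator (h1 _ hA)]

lemma condExp_sup_indep {Ω : Type*} {m₁ m₂ m₃ : MeasurableSpace Ω} [mΩ : MeasurableSpace Ω] {μ : Measure Ω} [IsProbabilityMeasure μ]
    (h1 : m₁ ≤ mΩ) (h2 : m₂ ≤ mΩ) (h3 : m₃ ≤ mΩ)
    (hind : Indep (m₁ ⊔ m₂) m₃ μ) {G : Ω → ℝ} (hG : StronglyMeasurable[m₁ ⊔ m₂] G)
    (hGi : Integrable G μ) : μ[G|m₁] =ᵐ[μ] μ[G|m₁ ⊔ m₃] := by
  have h12 : m₁ ⊔ m₂ ≤ mΩ := sup_le h1 h2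
  have h13 : m₁ ⊔ m₃ ≤ mΩ := sup_le h1 h3
  refine ae_eq_condExp_of_forall_setIntegral_eq h13 hGi
    (fun s _ _ => integrable_condExp.integrableOn) ?_
    ⟨μ[G|m₁], stronglyMeasurable_condExp.mono le_sup_left, Filter.EventuallyEq.rfl⟩
  intro s hs _
  let p : Set (Set Ω) := {s | ∃ A B, MeasurableSet[m₁] A ∧ MeasurableSet[m₃] B ∧ s = A ∩ B}
  have hp : m₁ ⊔ m₃ = MeasurableSpace.generateFrom p := by
    apply le_antisymm
    · refine sup_le ?_ ?_
      · intro A hA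
        exact MeasurableSpace.measurableSet_generateFrom ⟨A, Set.univ, hA, MeasurableSet.univ, by simp⟩
      · intro B hB
        exact MeasurableSpace.measurableSet_generateFrom ⟨Set.univ, B, MeasurableSet.univ, hB, by simp⟩
    · refine MeasurableSpace.generateFrom_le ?_
      rintro _ ⟨A, B, hA, hB, rfl⟩
      exact MeasurableSet.inter ((le_sup_left : m₁ ≤ m₁ ⊔ m₃) _ hA) ((le_sup_right : m₃ ≤ m₁ ⊔ m₃) _ hB)
  have hpi : IsPiSystem p := by
    rintro _ ⟨A, B, hA, hB, rfl⟩ _ ⟨A', B', hA', hB', rfl⟩ _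
    exact ⟨A ∩ A', B ∩ B', MeasurableSet.inter hA hA', MeasurableSet.inter hB hB', by
      rw [Set.inter_inter_inter_comm]⟩
  have huniv : ∫ ω, (μ[G|m₁]) ω ∂μ = ∫ ω, G ω ∂μ := integral_condExp h1
  induction s, hs using MeasurableSpace.induction_on_inter hp hpi with
  | empty => simp
  | basic t ht =>
    obtain ⟨A, B, hA, hB, rfl⟩ := ht
    rw [setInt_indep h12 h3 hind hG hGi ((le_sup_left : m₁ ≤ m₁ ⊔ m₂) _ hA) hB,
      setInt_indep h12 h3 hind (stronglyMeasurable_condExp.mono le_sup_left) integrable_condExp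
        ((le_sup_left : m₁ ≤ m₁ ⊔ m₂) _ hA) hB, setIntegral_condExp h1 hGi hA]
  | compl t ht ih =>
    rw [setIntegral_compl (h13 _ ht) integrable_condExp, setIntegral_compl (h13 _ ht) hGi, huniv,
      ih (measure_lt_top _ _)]
  | iUnion f hd hf ih =>
    rw [integral_iUnion (fun i => h13 _ (hf i)) hd integrable_condExp.integrableOn,
      integral_iUnion (fun i => h13 _ (hf i)) hd hGi.integrableOn]
    congr 1
    ext i
    exact ih i (measure_lt_top _ _)

lemma condExp_comm {Ω : Type*} {m₁ m₂ m₃ : MeasurableSpace Ω} [mΩ : MeasurableSpace Ω] {μ : Measure Ω} [IsProbabilityMeasure μ]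
    (h1 : m₁ ≤ mΩ) (h2 : m₂ ≤ mΩ) (h3 : m₃ ≤ mΩ)
    (hind : Indep (m₁ ⊔ m₂) m₃ μ) {f : Ω → ℝ} :
    μ[μ[f|m₁ ⊔ m₂]|m₁ ⊔ m₃] =ᵐ[μ] μ[f|m₁] :=
  (condExp_sup_indep h1 h2 h3 hind stronglyMeasurable_condExp integrable_condExp).symm.trans
    (condExp_condExp_of_le le_sup_left (sup_le h1 h2))

/-- Conditional expectation as a linear operator on `L²`. -/
noncomputable def cproj {Ω : Type*} {m : MeasurableSpace Ω} [mΩ : MeasurableSpace Ω] (μ : Measure Ω) (hm : m ≤ mΩ) :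
    Lp ℝ 2 μ →ₗ[ℝ] Lp ℝ 2 μ :=
  (lpMeas ℝ ℝ m 2 μ).subtype ∘ₗ (condExpL2 ℝ ℝ hm).toLinearMap

lemma cproj_ae {Ω : Type*} {m : MeasurableSpace Ω} [mΩ : MeasurableSpace Ω] {μ : Measure Ω} [IsProbabilityMeasure μ]
    (hm : m ≤ mΩ) {f : Ω → ℝ} {Y : Lp ℝ 2 μ}
    (hY : Y =ᵐ[μ] f) : cproj μ hm Y =ᵐ[μ] μ[f|m] := by
  have h := (Lp.memLp Y).condExpL2_ae_eq_condExp (𝕜 := ℝ) hm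
  rw [Lp.toLp_coeFn] at h
  exact h.trans (condExp_congr_ae hY)

theorem spectral {Ω : Type*} [mΩ : MeasurableSpace Ω] {μ : Measure Ω} [IsProbabilityMeasure μ]
    {ι κ : Type*} [DecidableEq ι] [Fintype ι] (m : ι → MeasurableSpace Ω)
    (hm : ∀ i, m i ≤ mΩ)
    (hcomm : ∀ i j (f : Ω → ℝ), μ[μ[f|m j]|m i] =ᵐ[μ] μ[μ[f|m i]|m j])
    (A : Finset κ) (s : κ → Finset ι) (F : κ → Ω → ℝ) (r : ℕ) (hr : 0 < r)
    (hcard : ∀ k ∈ A, (s k).card ≤ r) (hF : ∀ k ∈ A, MemLp (F k) 2 μ)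
    (hmeas : ∀ k ∈ A, ∀ i, i ∉ s k → StronglyMeasurable[m i] (F k))
    (V AV : Ω → ℝ) (hV : ∀ ω, V ω = ∑ k ∈ A, F k ω)
    (hAV : AV =ᵐ[μ] fun ω => V ω - (1 / (r : ℝ)) * ∑ i, (V ω - (μ[V|m i]) ω)) :
    ∫ ω, AV ω ^ 2 ∂μ ≤ ∫ ω, V ω * AV ω ∂μ := by
  have hVL : MemLp V 2 μ := by
    have : V = fun ω => ∑ k ∈ A, F k ω := funext hV
    rw [this]; exact memLp_finsetSum _ hF
  set Y := hVL.toLp V with hY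
  have hYae : Y =ᵐ[μ] V := hVL.coeFn_toLp
  have key := hilb2 (P := fun i => cproj μ (hm i)) (fun i x y => inner_condExpL2_left_eq_right (𝕜 := ℝ) (E := ℝ) (hm i))
    (fun i x => by
      apply Lp.ext
      have h1 := cproj_ae (hm i) (Filter.EventuallyEq.refl (ae μ) (x : Ω → ℝ))
      refine (cproj_ae (hm i) h1).trans (Filter.EventuallyEq.trans ?_ h1.symm)
      rw [condExp_of_stronglyMeasurable (hm i) stronglyMeasurable_condExp integrable_condExp])
    (fun i j x => by
      apply Lp.ext
      have hx := Filter.EventuallyEq.refl (ae μ) (x : Ω → ℝ)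
      exact (cproj_ae (hm i) (cproj_ae (hm j) hx)).trans
        ((hcomm i j x).trans (cproj_ae (hm j) (cproj_ae (hm i) hx)).symm))
    Finset.univ (r : ℝ) (by exact_mod_cast hr) Y (by
      have : Y = ∑ k ∈ A.attach, (hF k k.2).toLp (F k) := by
        apply Lp.ext
        refine hYae.trans ?_
        refine Filter.EventuallyEq.trans ?_ (Lp.coeFn_finsetSum _ _).symm
        have : ∀ᵐ ω ∂μ, ∀ k ∈ A.attach, (hF k k.2).toLp (F k) ω = F k ω := by
          rw [Filter.eventually_all_finset]
          intro k _
          exact (hF k k.2).coeFn_toLp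
        filter_upwards [this] with ω h
        rw [hV, Finset.sum_apply, Finset.sum_congr rfl h, Finset.sum_attach A (fun k => F k ω)]
      rw [this]
      refine Submodule.sum_mem _ fun k _ => Submodule.subset_span ⟨s k, ?_, ?_⟩
      · simpa using hcard k k.2
      · intro i _ hi
        apply Lp.ext
        refine (cproj_ae (hm i) (hF k k.2).coeFn_toLp).trans ?_
        rw [condExp_of_stronglyMeasurable (hm i) (hmeas k k.2 i hi)
          ((hF k k.2).integrable (by norm_num))]
        exact (hF k k.2).coeFn_toLp.symm)
  set Z := Y - (1 / (r : ℝ)) • ∑ i, (Y - cproj μ (hm i) Y) with hZ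
  have hZae : Z =ᵐ[μ] AV := by
    refine Filter.EventuallyEq.trans ?_ hAV.symm
    have h1 : ∀ᵐ ω ∂μ, ∀ i ∈ (Finset.univ : Finset ι), (Y - cproj μ (hm i) Y : Lp ℝ 2 μ) ω
        = V ω - (μ[V|m i]) ω := by
      rw [Filter.eventually_all_finset]
      intro i _
      filter_upwards [Lp.coeFn_sub Y (cproj μ (hm i) Y), hYae, cproj_ae (hm i) hYae] with ω a b c
      rw [a, Pi.sub_apply, b, c]
    filter_upwards [Lp.coeFn_sub Y ((1 / (r : ℝ)) • ∑ i, (Y - cproj μ (hm i) Y)),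
      Lp.coeFn_smul (1 / (r : ℝ)) (∑ i, (Y - cproj μ (hm i) Y)),
      Lp.coeFn_finsetSum Finset.univ (fun i => Y - cproj μ (hm i) Y), hYae, h1] with ω a b c e f
    rw [a, Pi.sub_apply, b, Pi.smul_apply, c, e, Finset.sum_apply, Finset.sum_congr rfl f, smul_eq_mul]
  rw [← real_inner_self_eq_norm_sq, L2.inner_def, L2.inner_def] at key
  have e1 : ∫ ω, AV ω ^ 2 ∂μ = ∫ ω, inner ℝ (Z ω) (Z ω) ∂μ := by
    apply integral_congr_ae
    filter_upwards [hZae] with ω h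
    rw [h]; simp [sq]
  have e2 : ∫ ω, V ω * AV ω ∂μ = ∫ ω, inner ℝ (Y ω) (Z ω) ∂μ := by
    apply integral_congr_ae
    filter_upwards [hZae, hYae] with ω h h'
    rw [h, h']; simp [mul_comm]
  rw [e1, e2]; exact key

end cond
end DJ

namespace DJ

section basics
variable {Ω : Type*} [mΩ : MeasurableSpace Ω] {μ : Measure Ω}

lemma mul42 {f g : Ω → ℝ} (hf : MemLp f 4 μ) (hg : MemLp g 4 μ) :
    MemLp (fun ω => f ω * g ω) 2 μ := by
  have : ENNReal.HolderTriple 4 4 2 := ⟨by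
    have h4 : (4 : ENNReal) = 2 * 2 := by norm_num
    rw [h4, ENNReal.mul_inv (by simp) (by simp), ← mul_add, ENNReal.inv_two_add_inv_two, mul_one]⟩
  exact hg.mul' hf

lemma sq42 {f : Ω → ℝ} (hf : MemLp f 4 μ) : MemLp (fun ω => f ω ^ 2) 2 μ := by
  simpa [sq] using mul42 hf hf

lemma int22 {f g : Ω → ℝ} (hf : MemLp f 2 μ) (hg : MemLp g 2 μ) :
    Integrable (fun ω => f ω * g ω) μ := hf.integrable_mul hg

lemma to2 [IsFiniteMeasure μ] {f : Ω → ℝ} (hf : MemLp f 4 μ) : MemLp f 2 μ :=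
  hf.mono_exponent (by norm_num)

lemma to1 [IsFiniteMeasure μ] {f : Ω → ℝ} (hf : MemLp f 2 μ) : Integrable f μ :=
  hf.integrable (by norm_num)

lemma int_pow4 {f : Ω → ℝ} (hf : MemLp f 4 μ) : Integrable (fun ω => f ω ^ 4) μ := by
  have := int22 (sq42 hf) (sq42 hf)
  refine this.congr (ae_of_all _ fun ω => ?_); simp only; ring

lemma iadd {f g : Ω → ℝ} (hf : Integrable f μ) (hg : Integrable g μ) :
    Integrable (fun ω => f ω + g ω) μ := hf.add hg

lemma isub {f g : Ω → ℝ} (hf : Integrable f μ) (hg : Integrable g μ) :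
    Integrable (fun ω => f ω - g ω) μ := hf.sub hg

lemma cs {f g : Ω → ℝ} (hf : MemLp f 2 μ) (hg : MemLp g 2 μ) :
    |∫ ω, f ω * g ω ∂μ| ≤ √(∫ ω, f ω ^ 2 ∂μ) * √(∫ ω, g ω ^ 2 ∂μ) := by
  have hf2 := hf.integrable_sq
  have hg2 := hg.integrable_sq
  have hfg := int22 hf hg
  have h0 : ∀ t : ℝ, 0 ≤ (∫ ω, f ω ^ 2 ∂μ) * (t * t) + 2 * (∫ ω, f ω * g ω ∂μ) * t
      + ∫ ω, g ω ^ 2 ∂μ := by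
    intro t
    have : (∫ ω, f ω ^ 2 ∂μ) * (t * t) + 2 * (∫ ω, f ω * g ω ∂μ) * t + ∫ ω, g ω ^ 2 ∂μ
        = ∫ ω, (f ω * t + g ω) ^ 2 ∂μ := by
      have e : ∀ ω, (f ω * t + g ω) ^ 2 = (t * t) * f ω ^ 2 + (2 * t) * (f ω * g ω) + g ω ^ 2 := by
        intro ω; ring
      simp_rw [e]
      rw [integral_add (iadd (hf2.const_mul _) (hfg.const_mul _)) hg2,
        integral_add (hf2.const_mul _) (hfg.const_mul _), integral_const_mul, integral_const_mul]
      ring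
    rw [this]; exact integral_nonneg fun ω => sq_nonneg _
  have := discrim_le_zero h0
  rw [discrim] at this
  have hA : 0 ≤ ∫ ω, f ω ^ 2 ∂μ := integral_nonneg fun ω => sq_nonneg _
  rw [← Real.sqrt_mul hA]
  apply Real.abs_le_sqrt
  nlinarith

lemma orth {m : MeasurableSpace Ω} [IsProbabilityMeasure μ] (hm : m ≤ mΩ) {F G : Ω → ℝ}
    (hG : StronglyMeasurable[m] G) (hF : Integrable F μ) (hGF : Integrable (fun ω => G ω * F ω) μ)
    (h0 : μ[F|m] =ᵐ[μ] 0) : ∫ ω, G ω * F ω ∂μ = 0 := by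
  have h1 := condExp_mul_of_stronglyMeasurable_left hG hGF hF
  rw [← integral_condExp hm]
  have : μ[fun ω => G ω * F ω|m] =ᵐ[μ] 0 := by
    refine h1.trans ?_
    filter_upwards [h0] with ω h
    simp [h]
  rw [integral_congr_ae this]; simp

end basics

theorem hyper {Ω : Type*} [mΩ : MeasurableSpace Ω] (μ : Measure Ω) [IsProbabilityMeasure μ]
    {ι κ : Type*} [DecidableEq ι] [DecidableEq κ] (m : ι → MeasurableSpace Ω) (hm : ∀ i, m i ≤ mΩ)
    (F : κ → Ω → ℝ) (T : Finset ι) :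
    ∀ (d : ℕ) (A : Finset κ) (s : κ → Finset ι), Set.InjOn s A →
      (∀ k ∈ A, s k ⊆ T) → (∀ k ∈ A, (s k).card ≤ d) → (∀ k ∈ A, MemLp (F k) 4 μ) →
      (∀ k ∈ A, ∀ i ∈ T, i ∉ s k → StronglyMeasurable[m i] (F k)) →
      (∀ k ∈ A, ∀ i ∈ s k, μ[F k|m i] =ᵐ[μ] 0) →
      ∫ ω, (∑ k ∈ A, F k ω) ^ 4 ∂μ ≤ 16 ^ d * (∑ k ∈ A, √(∫ ω, F k ω ^ 4 ∂μ)) ^ 2 := by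
  induction T using Finset.induction_on with
  | empty =>
    intro d A s hinj hT hd hF _ _
    have hcard : A.card ≤ 1 := by
      rw [Finset.card_le_one]
      intro a ha b hb
      apply hinj ha hb
      rw [Finset.subset_empty.1 (hT a ha), Finset.subset_empty.1 (hT b hb)]
    have h16 : (1 : ℝ) ≤ 16 ^ d := one_le_pow₀ (by norm_num)
    by_cases hne : A.Nonempty
    · obtain ⟨k, hk⟩ := Finset.card_eq_one.1 (le_antisymm hcard (Finset.card_pos.2 hne))
      subst hk
      simp only [Finset.sum_singleton]
      have hp : 0 ≤ ∫ ω, F k ω ^ 4 ∂μ := integral_nonneg fun ω => by positivity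
      rw [Real.sq_sqrt hp]
      nlinarith
    · rw [Finset.not_nonempty_iff_eq_empty] at hne
      subst hne; simp
  | insert i T hi ih =>
    intro d A s hinj hT hd hF hmeas hdeg
    set A1 := A.filter (fun k => i ∉ s k) with hA1
    set A2 := A.filter (fun k => i ∈ s k) with hA2
    have hG := ih d A1 s (hinj.mono (Finset.coe_subset.2 (Finset.filter_subset _ _))) (by
        intro k hk
        rw [Finset.mem_filter] at hk
        exact (Finset.subset_insert_iff_of_notMem hk.2).1 (hT k hk.1))
      (fun k hk => hd k (Finset.mem_filter.1 hk).1) (fun k hk => hF k (Finset.mem_filter.1 hk).1)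
      (fun k hk j hj => hmeas k (Finset.mem_filter.1 hk).1 j (Finset.mem_insert_of_mem hj))
      (fun k hk => hdeg k (Finset.mem_filter.1 hk).1)
    have hsplit : ∀ f : κ → ℝ, ∑ k ∈ A, f k = ∑ k ∈ A1, f k + ∑ k ∈ A2, f k := by
      intro f
      rw [add_comm, hA1, hA2, Finset.sum_filter_add_sum_filter_not]
    rcases Nat.eq_zero_or_pos d with h0 | hdpos
    · have : A2 = ∅ := by
        rw [hA2, Finset.filter_eq_empty_iff]
        intro k hk hik
        have := hd k hk
        have h1 := Finset.card_pos.2 ⟨i, hik⟩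
        omega
      simp only [hsplit, this, Finset.sum_empty, add_zero]
      exact hG
    obtain ⟨e, rfl⟩ : ∃ e, d = e + 1 := ⟨d - 1, by omega⟩
    have hH := ih e A2 (fun k => (s k).erase i) (by
        intro a ha b hb hab
        simp only [hA2, Finset.coe_filter, Set.mem_ofPred_eq] at ha hb
        apply hinj ha.1 hb.1
        rw [← Finset.insert_erase ha.2, ← Finset.insert_erase hb.2]
        simp only at hab
        rw [hab]) (by
        intro k hk
        rw [Finset.mem_filter] at hk
        exact Finset.subset_insert_iff.1 (hT k hk.1)) (by
        intro k hk
        rw [Finset.mem_filter] at hk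
        have := hd k hk.1
        rw [Finset.card_erase_of_mem hk.2]; omega)
      (fun k hk => hF k (Finset.mem_filter.1 hk).1)
      (by
        intro k hk j hj hjk
        refine hmeas k (Finset.mem_filter.1 hk).1 j (Finset.mem_insert_of_mem hj) ?_
        intro h
        apply hjk
        rw [Finset.mem_erase]
        exact ⟨fun h' => hi (h' ▸ hj), h⟩)
      (fun k hk j hj => hdeg k (Finset.mem_filter.1 hk).1 j (Finset.mem_of_mem_erase hj))
    set G : Ω → ℝ := fun ω => ∑ k ∈ A1, F k ω with hGdef
    set H : Ω → ℝ := fun ω => ∑ k ∈ A2, F k ω with hHdef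
    have hG4 : MemLp G 4 μ := memLp_finsetSum _ fun k hk => hF k (Finset.mem_filter.1 hk).1
    have hH4 : MemLp H 4 μ := memLp_finsetSum _ fun k hk => hF k (Finset.mem_filter.1 hk).1
    have hGm : StronglyMeasurable[m i] G := Finset.stronglyMeasurable_fun_sum _ fun k hk =>
      hmeas k (Finset.mem_filter.1 hk).1 i (Finset.mem_insert_self _ _) (Finset.mem_filter.1 hk).2
    have hG3H : ∫ ω, G ω ^ 3 * H ω ∂μ = 0 := by
      have e : ∀ ω, G ω ^ 3 * H ω = ∑ k ∈ A2, G ω ^ 3 * F k ω := by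
        intro ω; rw [hHdef, Finset.mul_sum]
      have hIntg : ∀ k ∈ A2, Integrable (fun ω => G ω ^ 3 * F k ω) μ := by
        intro k hk
        have := int22 (sq42 hG4) (mul42 hG4 (hF k (Finset.mem_filter.1 hk).1))
        refine this.congr (ae_of_all _ fun ω => ?_); simp only; ring
      simp_rw [e]
      rw [integral_finsetSum _ hIntg]
      refine Finset.sum_eq_zero fun k hk => ?_
      exact orth (hm i) (hGm.pow 3) (to1 (to2 (hF k (Finset.mem_filter.1 hk).1))) (hIntg k hk)
        (hdeg k (Finset.mem_filter.1 hk).1 i (Finset.mem_filter.1 hk).2)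
    have hi3 : Integrable (fun ω => G ω ^ 3 * H ω) μ := by
      refine (int22 (sq42 hG4) (mul42 hG4 hH4)).congr (ae_of_all _ fun ω => ?_); simp only; ring
    have hi2 : Integrable (fun ω => G ω ^ 2 * H ω ^ 2) μ := int22 (sq42 hG4) (sq42 hH4)
    have hcs : ∫ ω, G ω ^ 2 * H ω ^ 2 ∂μ ≤ √(∫ ω, G ω ^ 4 ∂μ) * √(∫ ω, H ω ^ 4 ∂μ) := by
      have := (abs_le.1 (cs (sq42 hG4) (sq42 hH4))).2
      simpa [← pow_mul] using this
    have hmain : ∫ ω, (G ω + H ω) ^ 4 ∂μ ≤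
        ∫ ω, G ω ^ 4 ∂μ + 8 * ∫ ω, G ω ^ 2 * H ω ^ 2 ∂μ + 3 * ∫ ω, H ω ^ 4 ∂μ := by
      have : ∫ ω, (G ω + H ω) ^ 4 ∂μ ≤
          ∫ ω, (G ω ^ 4 + 8 * (G ω ^ 2 * H ω ^ 2) + 3 * H ω ^ 4 + 4 * (G ω ^ 3 * H ω)) ∂μ := by
        refine integral_mono (int_pow4 (hG4.add hH4)) ?_ fun ω => ?_
        · exact (((int_pow4 hG4).add (hi2.const_mul 8)).add ((int_pow4 hH4).const_mul 3)).add
            (hi3.const_mul 4)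
        · simp only
          nlinarith [sq_nonneg (G ω * H ω - H ω ^ 2)]
      rw [integral_add (iadd (iadd (int_pow4 hG4) (hi2.const_mul 8)) ((int_pow4 hH4).const_mul 3))
        (hi3.const_mul 4), integral_add (iadd (int_pow4 hG4) (hi2.const_mul 8))
        ((int_pow4 hH4).const_mul 3), integral_add (int_pow4 hG4) (hi2.const_mul 8),
        integral_const_mul, integral_const_mul, integral_const_mul, hG3H] at this
      linarith
    simp only [hsplit]
    set a := ∑ k ∈ A1, √(∫ ω, F k ω ^ 4 ∂μ)
    set b := ∑ k ∈ A2, √(∫ ω, F k ω ^ 4 ∂μ)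
    have ha : 0 ≤ a := Finset.sum_nonneg fun k _ => Real.sqrt_nonneg _
    have hb : 0 ≤ b := Finset.sum_nonneg fun k _ => Real.sqrt_nonneg _
    have hp : (16 : ℝ) ^ e = 4 ^ e * 4 ^ e := by rw [← mul_pow]; norm_num
    have hpos : (0 : ℝ) < 4 ^ e := by positivity
    have hsG : √(∫ ω, G ω ^ 4 ∂μ) ≤ 4 * 4 ^ e * a := by
      apply Real.sqrt_le_iff.2 ⟨by positivity, hG.trans (le_of_eq _)⟩
      rw [pow_succ, hp]; ring
    have hsH : √(∫ ω, H ω ^ 4 ∂μ) ≤ 4 ^ e * b := by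
      apply Real.sqrt_le_iff.2 ⟨by positivity, hH.trans (le_of_eq _)⟩
      rw [hp]; ring
    have hGH := mul_le_mul hsG hsH (Real.sqrt_nonneg _) (by positivity)
    rw [pow_succ, hp] at hG ⊢
    rw [hp] at hH
    have hb2 : 0 ≤ 4 ^ e * 4 ^ e * b ^ 2 := by positivity
    calc ∫ ω, (G ω + H ω) ^ 4 ∂μ ≤ _ := hmain
      _ ≤ 4 ^ e * 4 ^ e * 16 * a ^ 2 + 8 * (4 * 4 ^ e * a * (4 ^ e * b))
          + 3 * (4 ^ e * 4 ^ e * b ^ 2) := by linarith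
      _ ≤ _ := by nlinarith

end DJ

namespace DJ

section one
variable {Ω : Type*} {m : MeasurableSpace Ω} [mΩ : MeasurableSpace Ω] {μ : Measure Ω}
  [IsProbabilityMeasure μ] {V G e : Ω → ℝ}

/-- Data attached to a single coordinate: `W = V + G` with `V` measurable w.r.t. `m`,
`E[G|m] = 0`, `e = E[G²|m]`. -/
structure One (m mΩ : MeasurableSpace Ω) (μ : Measure[mΩ] Ω) (V G e : Ω → ℝ) : Prop where
  hm : m ≤ mΩ
  hV : MemLp V 4 μ
  hG : MemLp G 4 μ
  mV : StronglyMeasurable[m] V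
  G0 : μ[G|m] =ᵐ[μ] 0
  he : MemLp e 2 μ
  me : StronglyMeasurable[m] e
  ee : μ[fun ω => G ω ^ 2|m] =ᵐ[μ] e

lemma One.mk' (hm : m ≤ mΩ) (hV : MemLp V 4 μ) (hG : MemLp G 4 μ)
    (mV : StronglyMeasurable[m] V) (G0 : μ[G|m] =ᵐ[μ] 0) :
    One m mΩ μ V G (μ[fun ω => G ω ^ 2|m]) :=
  ⟨hm, hV, hG, mV, G0, (sq42 hG).condExp (by norm_num), stronglyMeasurable_condExp, Filter.EventuallyEq.rfl⟩

lemma One.cGe (h : One m mΩ μ V G e) : μ[fun ω => G ω ^ 2 - e ω|m] =ᵐ[μ] 0 := by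
  have h1 := condExp_sub (m := m) (to1 (sq42 h.hG)) (to1 h.he)
  have h2 := condExp_of_stronglyMeasurable h.hm h.me (to1 h.he)
  have h3 : (fun ω => G ω ^ 2 - e ω) = (fun ω => G ω ^ 2) - e := rfl
  rw [h3]
  filter_upwards [h1, h.ee] with ω a b
  rw [a, Pi.sub_apply, b, h2]; simp

lemma One.i1 (h : One m mΩ μ V G e) {g : Ω → ℝ} (hg : StronglyMeasurable[m] g)
    (hi : Integrable (fun ω => g ω * G ω) μ) : ∫ ω, g ω * G ω ∂μ = 0 :=
  orth h.hm hg (to1 (to2 h.hG)) hi h.G0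

lemma One.i2 (h : One m mΩ μ V G e) {g : Ω → ℝ} (hg : StronglyMeasurable[m] g)
    (hi : Integrable (fun ω => g ω * (G ω ^ 2 - e ω)) μ) : ∫ ω, g ω * (G ω ^ 2 - e ω) ∂μ = 0 :=
  orth h.hm hg (isub (to1 (sq42 h.hG)) (to1 h.he)) hi h.cGe

lemma One.mD (h : One m mΩ μ V G e) : MemLp (fun ω => G ω ^ 2 - e ω) 2 μ :=
  (sq42 h.hG).sub h.he

lemma One.cW (h : One m mΩ μ V G e) : μ[fun ω => V ω + G ω|m] =ᵐ[μ] V := by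
  have h1 := condExp_add (m := m) (to1 (to2 h.hV)) (to1 (to2 h.hG))
  have h2 := condExp_of_stronglyMeasurable h.hm h.mV (to1 (to2 h.hV))
  have h3 : (fun ω => V ω + G ω) = V + G := rfl
  rw [h3]
  filter_upwards [h1, h.G0] with ω a b
  rw [a, Pi.add_apply, b, h2]; simp

lemma One.cW2 (h : One m mΩ μ V G e) :
    μ[fun ω => (V ω + G ω) ^ 2|m] =ᵐ[μ] fun ω => V ω ^ 2 + e ω := by
  have hVV := to1 (sq42 h.hV)
  have hVG := to1 (mul42 h.hV h.hG)
  have hGG := to1 (sq42 h.hG)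
  have h3 : (fun ω => (V ω + G ω) ^ 2)
      = ((fun ω => V ω ^ 2) + (2 : ℝ) • (fun ω => V ω * G ω)) + fun ω => G ω ^ 2 := by
    ext ω; simp; ring
  have h1 := condExp_add (m := m) (hVV.add (hVG.smul (2 : ℝ))) hGG
  have h2 := condExp_add (m := m) hVV (hVG.smul (2 : ℝ))
  have h4 := condExp_smul (m := m) (μ := μ) (2 : ℝ) (fun ω => V ω * G ω)
  have h5 := condExp_mul_of_stronglyMeasurable_left (m := m) h.mV hVG (to1 (to2 h.hG))
  have h6 := condExp_of_stronglyMeasurable h.hm (h.mV.pow 2) hVV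
  rw [h3]
  filter_upwards [h1, h2, h4, h5, h.ee, h.G0] with ω a b c d eq5 f
  rw [a, Pi.add_apply, b, Pi.add_apply, c, Pi.smul_apply]
  have h7 : (μ[fun ω => V ω * G ω|m]) ω = 0 := by
    have : (fun ω => V ω * G ω) = V * G := rfl
    rw [this, d, Pi.mul_apply, f]; simp
  have h8 : (μ[fun ω => V ω ^ 2|m]) ω = V ω ^ 2 := congrFun h6 ω
  rw [h7, h8, eq5]; simp

/-- moments -/
lemma One.eGam (h : One m mΩ μ V G e) :
    ∫ ω, (1 / 2 : ℝ) * (G ω ^ 2 + e ω) ∂μ = ∫ ω, G ω ^ 2 ∂μ := by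
  have h1 := to1 (sq42 h.hG)
  have h2 := h.i2 (g := fun _ => 1) stronglyMeasurable_const
    ((isub h1 (to1 h.he)).congr (ae_of_all _ fun ω => by simp))
  simp only [one_mul] at h2
  rw [integral_sub h1 (to1 h.he)] at h2
  rw [integral_const_mul, integral_add h1 (to1 h.he)]
  linarith

lemma One.eWG (h : One m mΩ μ V G e) :
    ∫ ω, (V ω + G ω) * G ω ∂μ = ∫ ω, G ω ^ 2 ∂μ := by
  have h1 := to1 (sq42 h.hG)
  have h2 := to1 (mul42 h.hV h.hG)
  have h3 := h.i1 h.mV h2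
  have e1 : ∀ ω, (V ω + G ω) * G ω = V ω * G ω + G ω ^ 2 := fun ω => by ring
  simp_rw [e1]
  rw [integral_add h2 h1, h3, zero_add]

lemma One.eWGam (h : One m mΩ μ V G e) :
    ∫ ω, (V ω + G ω) * ((1 / 2 : ℝ) * (G ω ^ 2 + e ω)) ∂μ
      = (1 / 2) * ∫ ω, (V ω + G ω) ^ 2 * G ω ∂μ := by
  have a1 := int22 (to2 h.hV) h.mD
  have a2 := int22 h.he (to2 h.hG)
  have a3 := int22 (sq42 h.hV) (to2 h.hG)
  have a4 := int22 (mul42 h.hV h.hG) (to2 h.hG)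
  have a5 := int22 (sq42 h.hG) (to2 h.hG)
  have b1 := h.i2 h.mV a1
  have b2 := h.i1 h.me a2
  have b3 := h.i1 (h.mV.pow 2) a3
  have key : ∫ ω, ((V ω + G ω) * ((1 / 2 : ℝ) * (G ω ^ 2 + e ω))
      - (1 / 2) * ((V ω + G ω) ^ 2 * G ω)) ∂μ = 0 := by
    have e1 : ∀ ω, ((V ω + G ω) * ((1 / 2 : ℝ) * (G ω ^ 2 + e ω))
      - (1 / 2) * ((V ω + G ω) ^ 2 * G ω)) =
      (-1 / 2) * (V ω * (G ω ^ 2 - e ω)) + ((1 / 2) * (e ω * G ω) + (-1 / 2) * (V ω ^ 2 * G ω)) :=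
      fun ω => by ring
    simp_rw [e1]
    have b3' : ∫ ω, V ω ^ 2 * G ω ∂μ = 0 := b3
    rw [integral_add (a1.const_mul _) (iadd (a2.const_mul _) (a3.const_mul _)),
      integral_add (a2.const_mul _) (a3.const_mul _), integral_const_mul, integral_const_mul,
      integral_const_mul, b1, b2, b3']; simp
  have hW : MemLp (fun ω => V ω + G ω) 4 μ := h.hV.add h.hG
  have hS : MemLp (fun ω => (1 / 2 : ℝ) * (G ω ^ 2 + e ω)) 2 μ :=
    ((sq42 h.hG).add h.he).const_mul (1 / 2 : ℝ)
  rw [integral_sub (int22 (to2 hW) hS) ((int22 (sq42 hW) (to2 h.hG)).const_mul _),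
    integral_const_mul] at key
  linarith

lemma One.ee2 (h : One m mΩ μ V G e) : ∫ ω, (G ω ^ 2 - e ω) ^ 2 ∂μ ≤ ∫ ω, G ω ^ 4 ∂μ
    ∧ ∫ ω, e ω ^ 2 ∂μ ≤ ∫ ω, G ω ^ 4 ∂μ := by
  have a1 := int22 h.he h.mD
  have b1 := h.i2 h.me a1
  have a2 := h.mD.integrable_sq
  have a3 := h.he.integrable_sq
  have key : ∫ ω, G ω ^ 4 ∂μ = ∫ ω, (G ω ^ 2 - e ω) ^ 2 ∂μ + ∫ ω, e ω ^ 2 ∂μ := by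
    have e1 : ∀ ω, G ω ^ 4 = (G ω ^ 2 - e ω) ^ 2 + e ω ^ 2 + 2 * (e ω * (G ω ^ 2 - e ω)) :=
      fun ω => by ring
    simp_rw [e1]
    rw [integral_add (iadd a2 a3) (a1.const_mul _), integral_add a2 a3, integral_const_mul, b1]
    simp
  have c1 : 0 ≤ ∫ ω, (G ω ^ 2 - e ω) ^ 2 ∂μ := integral_nonneg fun ω => sq_nonneg _
  have c2 : 0 ≤ ∫ ω, e ω ^ 2 ∂μ := integral_nonneg fun ω => sq_nonneg _
  constructor <;> linarith

lemma One.eW3G (h : One m mΩ μ V G e) :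
    3 * ∫ ω, (V ω + G ω) ^ 2 * ((1 / 2 : ℝ) * (G ω ^ 2 + e ω)) ∂μ
      ≤ (∫ ω, (V ω + G ω) ^ 3 * G ω ∂μ) + 2 * ∫ ω, G ω ^ 4 ∂μ := by
  have hW : MemLp (fun ω => V ω + G ω) 4 μ := h.hV.add h.hG
  have hS : MemLp (fun ω => (1 / 2 : ℝ) * (G ω ^ 2 + e ω)) 2 μ :=
    ((sq42 h.hG).add h.he).const_mul (1 / 2 : ℝ)
  have a1 := int22 (sq42 h.hV) h.mD
  have a2 := int22 h.he h.mD
  have a3 : Integrable (fun ω => (V ω * e ω) * G ω) μ :=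
    (int22 (mul42 h.hV h.hG) h.he).congr (ae_of_all _ fun ω => by simp only; ring)
  have a4 : Integrable (fun ω => V ω ^ 3 * G ω) μ :=
    (int22 (sq42 h.hV) (mul42 h.hV h.hG)).congr (ae_of_all _ fun ω => by simp only; ring)
  have a5 := int_pow4 h.hG
  have a6 := h.he.integrable_sq
  have b1 : ∫ ω, V ω ^ 2 * (G ω ^ 2 - e ω) ∂μ = 0 := h.i2 (h.mV.pow 2) a1
  have b2 := h.i2 h.me a2
  have b3 := h.i1 (h.mV.mul h.me) a3
  have b3' : ∫ ω, (V ω * e ω) * G ω ∂μ = 0 := b3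
  have b4 : ∫ ω, V ω ^ 3 * G ω ∂μ = 0 := h.i1 (h.mV.pow 3) a4
  have a7 : Integrable (fun ω => (V ω + G ω) ^ 3 * G ω) μ :=
    (int22 (sq42 hW) (mul42 hW h.hG)).congr (ae_of_all _ fun ω => by simp only; ring)
  have a8 := int22 (sq42 hW) hS
  have key : ∫ ω, (3 * ((V ω + G ω) ^ 2 * ((1 / 2 : ℝ) * (G ω ^ 2 + e ω)))
      - (V ω + G ω) ^ 3 * G ω) ∂μ = (1 / 2) * (∫ ω, G ω ^ 4 ∂μ) + (3 / 2) * ∫ ω, e ω ^ 2 ∂μ := by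
    have e1 : ∀ ω, (3 * ((V ω + G ω) ^ 2 * ((1 / 2 : ℝ) * (G ω ^ 2 + e ω)))
      - (V ω + G ω) ^ 3 * G ω) = ((1 / 2) * G ω ^ 4 + (3 / 2) * e ω ^ 2) +
      (((-3 / 2) * (V ω ^ 2 * (G ω ^ 2 - e ω)) + (3 / 2) * (e ω * (G ω ^ 2 - e ω)))
       + (3 * ((V ω * e ω) * G ω) + (-1) * (V ω ^ 3 * G ω))) := fun ω => by ring
    simp_rw [e1]
    rw [integral_add (iadd (a5.const_mul _) (a6.const_mul _)) (iadd
      (iadd (a1.const_mul _) (a2.const_mul _)) (iadd (a3.const_mul _) (a4.const_mul _))),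
      integral_add (a5.const_mul _) (a6.const_mul _),
      integral_add (iadd (a1.const_mul _) (a2.const_mul _)) (iadd (a3.const_mul _) (a4.const_mul _)),
      integral_add (a1.const_mul _) (a2.const_mul _), integral_add (a3.const_mul _) (a4.const_mul _)]
    simp only [integral_const_mul, b1, b2, b3', b4]
    ring
  rw [integral_sub (a8.const_mul _) a7, integral_const_mul] at key
  have := h.ee2.2
  linarith

/-- Stein remainder for a single coordinate. -/
lemma One.stein (h : One m mΩ μ V G e) (f f1 : ℝ → ℝ) (hf : ∀ t, HasDerivAt f (f1 t) t)
    (B B1 M : ℝ) (hM : 0 ≤ M) (bf : ∀ t, |f t| ≤ B) (bf1 : ∀ t, |f1 t| ≤ B1)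
    (lf : ∀ x y, |f1 x - f1 y| ≤ M * |x - y|) :
    |(∫ ω, f (V ω + G ω) * G ω ∂μ) - ∫ ω, f1 (V ω + G ω) * ((1 / 2 : ℝ) * (G ω ^ 2 + e ω)) ∂μ|
      ≤ 2 * M * (√(∫ ω, G ω ^ 2 ∂μ) * √(∫ ω, G ω ^ 4 ∂μ)) := by
  have fc : Continuous f := continuous_iff_continuousAt.2 fun t => (hf t).continuousAt
  have f1c : Continuous f1 := by
    have : LipschitzWith (Real.toNNReal M) f1 := LipschitzWith.of_dist_le_mul fun x y => by
      rw [Real.dist_eq, Real.dist_eq, Real.coe_toNNReal _ hM]; exact lf x y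
    exact this.continuous
  have hW : MemLp (fun ω => V ω + G ω) 4 μ := h.hV.add h.hG
  have hS : MemLp (fun ω => (1 / 2 : ℝ) * (G ω ^ 2 + e ω)) 2 μ :=
    ((sq42 h.hG).add h.he).const_mul (1 / 2 : ℝ)
  have bd : ∀ (φ : ℝ → ℝ) (c : ℝ), Continuous φ → (∀ t, |φ t| ≤ c) → ∀ (Y Z : Ω → ℝ),
      MemLp Y 4 μ → Integrable Z μ → Integrable (fun ω => φ (Y ω) * Z ω) μ :=
    fun φ c hφ hc Y Z hY hZ => hZ.bdd_mul (hφ.comp_aestronglyMeasurable hY.1)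
      (ae_of_all _ fun ω => (hc (Y ω)))
  have c1 := bd f B fc bf _ _ hW (to1 (to2 h.hG))
  have c2 := bd f B fc bf _ _ h.hV (to1 (to2 h.hG))
  have c3 := bd f1 B1 f1c bf1 _ _ hW (to1 hS)
  have c4 := bd f1 B1 f1c bf1 _ _ h.hV (to1 h.mD)
  have d1 := h.i1 (g := fun ω => f (V ω)) (fc.comp_stronglyMeasurable h.mV) c2
  have d2 := h.i2 (g := fun ω => f1 (V ω)) (f1c.comp_stronglyMeasurable h.mV) c4
  have key : (∫ ω, f (V ω + G ω) * G ω ∂μ)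
      - ∫ ω, f1 (V ω + G ω) * ((1 / 2 : ℝ) * (G ω ^ 2 + e ω)) ∂μ
      = ∫ ω, ((f (V ω + G ω) * G ω - f1 (V ω + G ω) * ((1 / 2 : ℝ) * (G ω ^ 2 + e ω)))
        - (f (V ω) * G ω + (1 / 2) * (f1 (V ω) * (G ω ^ 2 - e ω)))) ∂μ := by
    rw [integral_sub (isub c1 c3) (iadd c2 (c4.const_mul _)), integral_sub c1 c3,
      integral_add c2 (c4.const_mul _), integral_const_mul, d1, d2]
    simp
  have hGa : MemLp (fun ω => |G ω|) 2 μ := (to2 h.hG).abs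
  have hDa : MemLp (fun ω => |G ω ^ 2 - e ω|) 2 μ := h.mD.abs
  have j1 := int22 hGa (sq42 h.hG)
  have j2 := int22 hGa hDa
  have pt : ∀ ω, |(f (V ω + G ω) * G ω - f1 (V ω + G ω) * ((1 / 2 : ℝ) * (G ω ^ 2 + e ω)))
        - (f (V ω) * G ω + (1 / 2) * (f1 (V ω) * (G ω ^ 2 - e ω)))|
        ≤ M * (|G ω| * G ω ^ 2) + M * (|G ω| * |G ω ^ 2 - e ω|) := by
    intro ω
    have t1 : |f (V ω + G ω) - f (V ω) - f1 (V ω + G ω) * G ω| ≤ M * G ω ^ 2 := by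
      have := (convex_uIcc (V ω) (V ω + G ω)).norm_image_sub_le_of_norm_hasDerivWithin_le
        (f := fun x => f x - f1 (V ω + G ω) * x) (f' := fun x => f1 x - f1 (V ω + G ω))
        (C := M * |G ω|) (x := V ω) (y := V ω + G ω)
        (fun x _ => (by
          have := ((hf x).sub ((hasDerivAt_id x).const_mul (f1 (V ω + G ω)))).hasDerivWithinAt
            (s := Set.uIcc (V ω) (V ω + G ω))
          rw [mul_one] at this
          exact this))
        (fun x hx => by
          rw [Real.norm_eq_abs]
          refine (lf _ _).trans (mul_le_mul_of_nonneg_left ?_ hM)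
          have := Set.abs_sub_right_of_mem_uIcc hx
          rw [abs_sub_comm]
          simpa using this)
        Set.left_mem_uIcc Set.right_mem_uIcc
      simp only [Real.norm_eq_abs, add_sub_cancel_left] at this
      calc _ = |f (V ω + G ω) - f1 (V ω + G ω) * (V ω + G ω) - (f (V ω) - f1 (V ω + G ω) * V ω)| := by
            congr 1; ring
        _ ≤ _ := this
        _ = M * G ω ^ 2 := by rw [mul_assoc, abs_mul_abs_self]; ring
    have t2 : |f1 (V ω + G ω) - f1 (V ω)| ≤ M * |G ω| := by simpa using lf (V ω + G ω) (V ω)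
    have e1 : (f (V ω + G ω) * G ω - f1 (V ω + G ω) * ((1 / 2 : ℝ) * (G ω ^ 2 + e ω)))
        - (f (V ω) * G ω + (1 / 2) * (f1 (V ω) * (G ω ^ 2 - e ω)))
        = (f (V ω + G ω) - f (V ω) - f1 (V ω + G ω) * G ω) * G ω
          + (1 / 2) * ((f1 (V ω + G ω) - f1 (V ω)) * (G ω ^ 2 - e ω)) := by ring
    rw [e1]
    refine (abs_add_le _ _).trans (add_le_add ?_ ?_)
    · rw [abs_mul]
      calc _ ≤ (M * G ω ^ 2) * |G ω| := mul_le_mul_of_nonneg_right t1 (abs_nonneg _)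
        _ = _ := by ring
    · rw [abs_mul, abs_mul]
      have := mul_le_mul_of_nonneg_right t2 (abs_nonneg (G ω ^ 2 - e ω))
      have h0 : 0 ≤ |f1 (V ω + G ω) - f1 (V ω)| * |G ω ^ 2 - e ω| := by positivity
      rw [abs_of_pos (by norm_num : (0 : ℝ) < 1 / 2)]
      linarith
  rw [key]
  have s1 : ∫ ω, |G ω| * G ω ^ 2 ∂μ ≤ √(∫ ω, G ω ^ 2 ∂μ) * √(∫ ω, G ω ^ 4 ∂μ) := by
    refine (le_abs_self _).trans ((cs hGa (sq42 h.hG)).trans (le_of_eq ?_))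
    simp only [sq_abs, ← pow_mul]
  have s2 : ∫ ω, |G ω| * |G ω ^ 2 - e ω| ∂μ ≤ √(∫ ω, G ω ^ 2 ∂μ) * √(∫ ω, G ω ^ 4 ∂μ) := by
    refine (le_abs_self _).trans ((cs hGa hDa).trans ?_)
    simp only [sq_abs]
    exact mul_le_mul_of_nonneg_left (Real.sqrt_le_sqrt h.ee2.1) (Real.sqrt_nonneg _)
  calc _ ≤ ∫ ω, |(f (V ω + G ω) * G ω - f1 (V ω + G ω) * ((1 / 2 : ℝ) * (G ω ^ 2 + e ω)))
        - (f (V ω) * G ω + (1 / 2) * (f1 (V ω) * (G ω ^ 2 - e ω)))| ∂μ := abs_integral_le_integral_abs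
    _ ≤ ∫ ω, (M * (|G ω| * G ω ^ 2) + M * (|G ω| * |G ω ^ 2 - e ω|)) ∂μ :=
      integral_mono (isub (isub c1 c3) (iadd c2 (c4.const_mul _))).abs
        (iadd (j1.const_mul _) (j2.const_mul _)) pt
    _ = M * (∫ ω, |G ω| * G ω ^ 2 ∂μ) + M * ∫ ω, |G ω| * |G ω ^ 2 - e ω| ∂μ := by
      rw [integral_add (j1.const_mul _) (j2.const_mul _), integral_const_mul, integral_const_mul]
    _ ≤ _ := by
      have := mul_le_mul_of_nonneg_left s1 hM
      have := mul_le_mul_of_nonneg_left s2 hM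
      linarith

end one
end DJ

namespace DJ

section glob
variable {Ω : Type*} [mΩ : MeasurableSpace Ω] {μ : Measure Ω}
  [IsProbabilityMeasure μ] {ι : Type*} [Fintype ι] {m : ι → MeasurableSpace Ω}
  {V G e : ι → Ω → ℝ} {W S : Ω → ℝ} {d ν : ℝ}

/-- Global data. -/
structure Glob (mΩ : MeasurableSpace Ω) (μ : Measure[mΩ] Ω) (m : ι → MeasurableSpace Ω)
    (V G e : ι → Ω → ℝ) (W S : Ω → ℝ) (d ν : ℝ) : Prop where
  one : ∀ i, One (m i) mΩ μ (V i) (G i) (e i)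
  hW : ∀ i ω, V i ω + G i ω = W ω
  hs : ∀ ω, ∑ i, G i ω = d * W ω
  hd : 0 < d
  W4 : MemLp W 4 μ
  EW : ∫ ω, W ω ∂μ = 0
  EW2 : ∫ ω, W ω ^ 2 ∂μ = 2 * ν
  hS : ∀ ω, S ω = (1 / d) * ∑ i, (1 / 2 : ℝ) * (G i ω ^ 2 + e i ω)

lemma Glob.mGam (h : Glob mΩ μ m V G e W S d ν) (i : ι) :
    MemLp (fun ω => (1 / 2 : ℝ) * (G i ω ^ 2 + e i ω)) 2 μ :=
  ((sq42 (h.one i).hG).add (h.one i).he).const_mul (1 / 2 : ℝ)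

lemma Glob.S2 (h : Glob mΩ μ m V G e W S d ν) : MemLp S 2 μ := by
  have : S = fun ω => (1 / d) * ∑ i, (1 / 2 : ℝ) * (G i ω ^ 2 + e i ω) := funext h.hS
  rw [this]
  exact (memLp_finsetSum _ fun i _ => h.mGam i).const_mul (1 / d)

/-- Pull the sum out of integrals against `G`. -/
lemma Glob.sumG (h : Glob mΩ μ m V G e W S d ν) (φ : Ω → ℝ)
    (hi : ∀ i, Integrable (fun ω => φ ω * G i ω) μ) :
    ∑ i, ∫ ω, φ ω * G i ω ∂μ = d * ∫ ω, φ ω * W ω ∂μ := by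
  rw [← integral_finsetSum _ fun i _ => hi i, ← integral_const_mul]
  congr 1; ext ω
  rw [← Finset.mul_sum, h.hs]; ring

lemma Glob.sumS (h : Glob mΩ μ m V G e W S d ν) (φ : Ω → ℝ)
    (hi : ∀ i, Integrable (fun ω => φ ω * ((1 / 2 : ℝ) * (G i ω ^ 2 + e i ω))) μ) :
    ∑ i, ∫ ω, φ ω * ((1 / 2 : ℝ) * (G i ω ^ 2 + e i ω)) ∂μ = d * ∫ ω, φ ω * S ω ∂μ := by
  rw [← integral_finsetSum _ fun i _ => hi i, ← integral_const_mul]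
  congr 1; ext ω
  have := h.hd.ne'
  rw [← Finset.mul_sum, h.hS]; field_simp

lemma Glob.sumG2 (h : Glob mΩ μ m V G e W S d ν) : ∑ i, ∫ ω, G i ω ^ 2 ∂μ = d * (2 * ν) := by
  have h1 := h.sumG W fun i => int22 (to2 h.W4) (to2 (h.one i).hG)
  have h2 : ∀ i, ∫ ω, W ω * G i ω ∂μ = ∫ ω, G i ω ^ 2 ∂μ := fun i => by
    have := (h.one i).eWG
    simpa only [h.hW] using this
  simp_rw [h2] at h1
  rw [h1, ← h.EW2]
  simp only [sq]

lemma Glob.ES (h : Glob mΩ μ m V G e W S d ν) : ∫ ω, S ω ∂μ = 2 * ν := by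
  have h1 := h.sumS (fun _ => 1) fun i => (to1 (h.mGam i)).const_mul 1
  simp only [one_mul] at h1
  have h2 : ∀ i, ∫ ω, (1 / 2 : ℝ) * (G i ω ^ 2 + e i ω) ∂μ = ∫ ω, G i ω ^ 2 ∂μ :=
    fun i => (h.one i).eGam
  simp_rw [h2] at h1
  rw [h.sumG2] at h1
  exact (mul_left_cancel₀ h.hd.ne' h1).symm

lemma Glob.EWS (h : Glob mΩ μ m V G e W S d ν) :
    ∫ ω, W ω * S ω ∂μ = (1 / 2) * ∫ ω, W ω ^ 3 ∂μ := by
  have h1 := h.sumS W fun i => int22 (to2 h.W4) (h.mGam i)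
  have h2 : ∀ i, ∫ ω, W ω * ((1 / 2 : ℝ) * (G i ω ^ 2 + e i ω)) ∂μ
      = (1 / 2) * ∫ ω, W ω ^ 2 * G i ω ∂μ := fun i => by
    have := (h.one i).eWGam
    simpa only [h.hW] using this
  have h3 := h.sumG (fun ω => W ω ^ 2) fun i => int22 (sq42 h.W4) (to2 (h.one i).hG)
  simp_rw [h2] at h1
  rw [← Finset.mul_sum, h3] at h1
  have h4 : ∫ ω, W ω ^ 2 * W ω ∂μ = ∫ ω, W ω ^ 3 ∂μ := by congr 1
  rw [h4] at h1
  have := h.hd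
  apply mul_left_cancel₀ h.hd.ne'
  linarith

lemma Glob.EW2S (h : Glob mΩ μ m V G e W S d ν) :
    3 * ∫ ω, W ω ^ 2 * S ω ∂μ ≤ (∫ ω, W ω ^ 4 ∂μ) + (2 / d) * ∑ i, ∫ ω, G i ω ^ 4 ∂μ := by
  have h1 := h.sumS (fun ω => W ω ^ 2) fun i => int22 (sq42 h.W4) (h.mGam i)
  have h2 : ∀ i, 3 * ∫ ω, W ω ^ 2 * ((1 / 2 : ℝ) * (G i ω ^ 2 + e i ω)) ∂μ
      ≤ (∫ ω, W ω ^ 3 * G i ω ∂μ) + 2 * ∫ ω, G i ω ^ 4 ∂μ := fun i => by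
    have := (h.one i).eW3G
    simpa only [h.hW] using this
  have h3 := h.sumG (fun ω => W ω ^ 3) fun i =>
    (int22 (sq42 h.W4) (mul42 h.W4 (h.one i).hG)).congr (ae_of_all _ fun ω => by simp only; ring)
  have h4 : ∫ ω, W ω ^ 3 * W ω ∂μ = ∫ ω, W ω ^ 4 ∂μ := by congr 1
  have h5 := Finset.sum_le_sum fun i (_ : i ∈ Finset.univ) => h2 i
  rw [← Finset.mul_sum, h1, Finset.sum_add_distrib, h3, ← Finset.mul_sum, h4] at h5
  have := h.hd
  rw [div_mul_eq_mul_div, ← sub_le_iff_le_add', le_div_iff₀ this]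
  linarith

lemma Glob.stein (h : Glob mΩ μ m V G e W S d ν) (f f1 : ℝ → ℝ) (hf : ∀ t, HasDerivAt f (f1 t) t)
    (B B1 M : ℝ) (hM : 0 ≤ M) (bf : ∀ t, |f t| ≤ B) (bf1 : ∀ t, |f1 t| ≤ B1)
    (lf : ∀ x y, |f1 x - f1 y| ≤ M * |x - y|) :
    |(∫ ω, f (W ω) * W ω ∂μ) - ∫ ω, f1 (W ω) * S ω ∂μ|
      ≤ (2 * M / d) * ∑ i, √(∫ ω, G i ω ^ 2 ∂μ) * √(∫ ω, G i ω ^ 4 ∂μ) := by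
  have fc : Continuous f := continuous_iff_continuousAt.2 fun t => (hf t).continuousAt
  have f1c : Continuous f1 := by
    have : LipschitzWith (Real.toNNReal M) f1 := LipschitzWith.of_dist_le_mul fun x y => by
      rw [Real.dist_eq, Real.dist_eq, Real.coe_toNNReal _ hM]; exact lf x y
    exact this.continuous
  have bd : ∀ (φ : ℝ → ℝ) (c : ℝ), Continuous φ → (∀ t, |φ t| ≤ c) → ∀ (Z : Ω → ℝ),
      Integrable Z μ → Integrable (fun ω => φ (W ω) * Z ω) μ :=
    fun φ c hφ hc Z hZ => hZ.bdd_mul (hφ.comp_aestronglyMeasurable h.W4.1)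
      (ae_of_all _ fun ω => (hc (W ω)))
  have h1 := h.sumG (fun ω => f (W ω)) fun i => bd f B fc bf _ (to1 (to2 (h.one i).hG))
  have h2 := h.sumS (fun ω => f1 (W ω)) fun i => bd f1 B1 f1c bf1 _ (to1 (h.mGam i))
  have h3 : ∀ i, |(∫ ω, f (W ω) * G i ω ∂μ)
      - ∫ ω, f1 (W ω) * ((1 / 2 : ℝ) * (G i ω ^ 2 + e i ω)) ∂μ|
      ≤ 2 * M * (√(∫ ω, G i ω ^ 2 ∂μ) * √(∫ ω, G i ω ^ 4 ∂μ)) := fun i => by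
    have := (h.one i).stein f f1 hf B B1 M hM bf bf1 lf
    simpa only [h.hW] using this
  have h4 := (Finset.abs_sum_le_sum_abs _ _).trans
    (Finset.sum_le_sum fun i (_ : i ∈ Finset.univ) => h3 i)
  rw [Finset.sum_sub_distrib, h1, h2, ← mul_sub, abs_mul, abs_of_pos h.hd, ← Finset.mul_sum] at h4
  rw [div_mul_eq_mul_div, le_div_iff₀ h.hd]
  linarith

/-- variance bound -/
lemma Glob.AV [DecidableEq ι] (h : Glob mΩ μ m V G e W S d ν)
    (hcomm : ∀ i j (f : Ω → ℝ), μ[μ[f|m j]|m i] =ᵐ[μ] μ[μ[f|m i]|m j])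
    {κ : Type*}
    (A : Finset κ) (s : κ → Finset ι) (F : κ → Ω → ℝ) (r : ℕ) (hr : (r : ℝ) = d)
    (hcard : ∀ k ∈ A, (s k).card ≤ r) (hF : ∀ k ∈ A, MemLp (F k) 4 μ)
    (hmeas : ∀ k ∈ A, ∀ i, i ∉ s k → StronglyMeasurable[m i] (F k))
    (hWs : ∀ ω, W ω = ∑ k ∈ A, F k ω) (hA : A.Nonempty) :
    ∫ ω, (S ω - 2 * ν - 2 * W ω) ^ 2 ∂μ ≤
      (1 / 3) * (((∫ ω, W ω ^ 4 ∂μ) - 12 * (∫ ω, W ω ^ 3 ∂μ) - 12 * ν ^ 2 + 48 * ν)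
        + (2 / d) * ∑ i, ∫ ω, G i ω ^ 4 ∂μ) := by
  have hr0 : 0 < r := by
    have := h.hd
    rw [← hr] at this
    exact_mod_cast this
  have hN : (A.card : ℝ) ≠ 0 := by exact_mod_cast hA.card_pos.ne'
  have iW := to1 (to2 h.W4)
  have iW2 := to1 (sq42 h.W4)
  have hsp := spectral (μ := μ) m (fun i => (h.one i).hm) hcomm (A ×ˢ A) (fun p => s p.1 ∪ s p.2)
    (fun p ω => F p.1 ω * F p.2 ω - (4 / (A.card : ℝ)) * F p.1 ω - 2 * ν / ((A.card : ℝ) ^ 2))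
    (2 * r) (by positivity)
    (fun p hp => by
      rw [Finset.mem_product] at hp
      have := Finset.card_union_le (s p.1) (s p.2)
      have := hcard _ hp.1
      have := hcard _ hp.2
      omega)
    (fun p hp => by
      rw [Finset.mem_product] at hp
      exact ((mul42 (hF _ hp.1) (hF _ hp.2)).sub ((to2 (hF _ hp.1)).const_mul _)).sub
        (memLp_const _))
    (fun p hp i hi => by
      rw [Finset.mem_product] at hp
      rw [Finset.mem_union, not_or] at hi
      have a1 := hmeas _ hp.1 i hi.1
      have a2 := hmeas _ hp.2 i hi.2
      exact ((a1.mul a2).sub (a1.const_mul _)).sub stronglyMeasurable_const)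
    (fun ω => W ω ^ 2 - 2 * ν - 4 * W ω) (fun ω => S ω - 2 * ν - 2 * W ω)
    (fun ω => by
      have q1 : ∑ p ∈ A ×ˢ A, F p.1 ω * F p.2 ω = W ω ^ 2 := by
        rw [sq, hWs, Finset.sum_mul_sum, Finset.sum_product]
      have q2 : ∑ p ∈ A ×ˢ A, (4 / (A.card : ℝ)) * F p.1 ω = 4 * W ω := by
        rw [← Finset.mul_sum, Finset.sum_product]
        simp only [Finset.sum_const, nsmul_eq_mul]
        rw [← Finset.mul_sum, hWs]
        field_simp
      have q3 : ∑ p ∈ A ×ˢ A, 2 * ν / ((A.card : ℝ) ^ 2) = 2 * ν := by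
        rw [Finset.sum_const, Finset.card_product, nsmul_eq_mul]
        push_cast
        field_simp
      rw [Finset.sum_sub_distrib, Finset.sum_sub_distrib, q1, q2, q3]
      ring)
    (by
      have hi : ∀ i, (μ[fun ω => W ω ^ 2 - 2 * ν - 4 * W ω|m i]) =ᵐ[μ]
          fun ω => (V i ω ^ 2 + e i ω) - 2 * ν - 4 * V i ω := by
        intro i
        have a1 := (h.one i).cW
        have a2 := (h.one i).cW2
        simp only [h.hW] at a1 a2
        have e1 : (fun ω => W ω ^ 2 - 2 * ν - 4 * W ω)
          = ((fun ω => W ω ^ 2) - fun _ => 2 * ν) - (4 : ℝ) • W := by ext ω; simp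
        rw [e1]
        have a3 := condExp_sub (m := m i) (iW2.sub (integrable_const (2 * ν))) (iW.smul (4 : ℝ))
        have a4 := condExp_sub (m := m i) iW2 (integrable_const (2 * ν))
        have a5 := condExp_smul (m := m i) (μ := μ) (4 : ℝ) W
        have a6 := condExp_const (μ := μ) (h.one i).hm (2 * ν)
        filter_upwards [a1, a2, a3, a4, a5] with ω b1 b2 b3 b4 b5
        have b1' : (μ[W|m i]) ω = V i ω := b1
        rw [b3, Pi.sub_apply, b4, Pi.sub_apply, b5, Pi.smul_apply, b2, b1', a6]
        simp
      filter_upwards [ae_all_iff.2 hi] with ω hω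
      simp only [hω]
      have e2 : ∀ i, W ω ^ 2 - 2 * ν - 4 * W ω - (V i ω ^ 2 + e i ω - 2 * ν - 4 * V i ω)
        = (2 * W ω - 4) * G i ω - 2 * ((1 / 2 : ℝ) * (G i ω ^ 2 + e i ω)) := fun i => by
        rw [← h.hW i]; ring
      simp_rw [e2]
      have hS' : ∑ i, (1 / 2 : ℝ) * (G i ω ^ 2 + e i ω) = d * S ω := by
        have := h.hd.ne'
        rw [h.hS]; field_simp
      rw [Finset.sum_sub_distrib, ← Finset.mul_sum, ← Finset.mul_sum, h.hs, hS']
      push_cast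
      rw [hr]
      have := h.hd.ne'
      field_simp
      ring)
  have iS := to1 h.S2
  have iWS := int22 (to2 h.W4) h.S2
  have iW2S := int22 (sq42 h.W4) h.S2
  have iW3 : Integrable (fun ω => W ω ^ 3) μ :=
    (int22 (sq42 h.W4) (to2 h.W4)).congr (ae_of_all _ fun ω => by simp only; ring)
  have e3 : ∫ ω, (W ω ^ 2 - 2 * ν - 4 * W ω) * (S ω - 2 * ν - 2 * W ω) ∂μ
      = (∫ ω, W ω ^ 2 * S ω ∂μ) - 4 * (∫ ω, W ω ^ 3 ∂μ) - 4 * ν ^ 2 + 16 * ν := by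
    have e4 : ∀ ω, (W ω ^ 2 - 2 * ν - 4 * W ω) * (S ω - 2 * ν - 2 * W ω)
      = (((W ω ^ 2 * S ω + (-2) * W ω ^ 3) + ((8 - 2 * ν) * W ω ^ 2 + (-2 * ν) * S ω))
        + ((-4) * (W ω * S ω) + (12 * ν) * W ω)) + 4 * ν ^ 2 := fun ω => by ring
    simp_rw [e4]
    rw [integral_add (iadd (iadd (iadd iW2S (iW3.const_mul _)) (iadd (iW2.const_mul _)
        (iS.const_mul _))) (iadd (iWS.const_mul _) (iW.const_mul _))) (integrable_const _),
      integral_add (iadd (iadd iW2S (iW3.const_mul _)) (iadd (iW2.const_mul _)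
        (iS.const_mul _))) (iadd (iWS.const_mul _) (iW.const_mul _)),
      integral_add (iadd iW2S (iW3.const_mul _)) (iadd (iW2.const_mul _) (iS.const_mul _)),
      integral_add iW2S (iW3.const_mul _), integral_add (iW2.const_mul _) (iS.const_mul _),
      integral_add (iWS.const_mul _) (iW.const_mul _)]
    simp only [integral_const_mul, h.EW, h.EW2, h.EWS, h.ES, integral_const, probReal_univ]
    simp only [smul_eq_mul]
    ring
  rw [e3] at hsp
  have := h.EW2S
  linarith

end glob
end DJ

namespace DJ

section ustat
variable {Ω : Type*} [mΩ : MeasurableSpace Ω] {μ : Measure Ω}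
  [IsProbabilityMeasure μ] {ι : Type*} [Fintype ι] [DecidableEq ι]

lemma sum_sq_orth (m : ι → MeasurableSpace Ω) (hm : ∀ i, m i ≤ mΩ) (d : ℕ)
    (A : Finset (Finset ι)) (F : Finset ι → Ω → ℝ)
    (hcard : ∀ J ∈ A, J.card = d) (hF : ∀ J ∈ A, MemLp (F J) 4 μ)
    (hmeas : ∀ J ∈ A, ∀ i, i ∉ J → StronglyMeasurable[m i] (F J))
    (h0 : ∀ J ∈ A, ∀ i ∈ J, μ[F J|m i] =ᵐ[μ] 0) :
    ∫ ω, (∑ J ∈ A, F J ω) ^ 2 ∂μ = ∑ J ∈ A, ∫ ω, F J ω ^ 2 ∂μ := by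
  have hi : ∀ J ∈ A, ∀ K ∈ A, Integrable (fun ω => F J ω * F K ω) μ := fun J hJ K hK =>
    int22 (to2 (hF J hJ)) (to2 (hF K hK))
  have e1 : ∀ ω, (∑ J ∈ A, F J ω) ^ 2 = ∑ J ∈ A, ∑ K ∈ A, F J ω * F K ω := fun ω => by
    rw [sq, Finset.sum_mul_sum]
  simp_rw [e1]
  rw [integral_finsetSum _ fun J hJ => integrable_finsetSum _ fun K hK => hi J hJ K hK]
  refine Finset.sum_congr rfl fun J hJ => ?_
  rw [integral_finsetSum _ fun K hK => hi J hJ K hK, Finset.sum_eq_single J]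
  · simp only [sq]
  · intro K hK hne
    have : ¬ K ⊆ J := fun hs => hne (Finset.eq_of_subset_of_card_le hs
      (by rw [hcard J hJ, hcard K hK]))
    obtain ⟨i, hiK, hiJ⟩ := Finset.not_subset.1 this
    exact orth (hm i) (hmeas J hJ i hiJ) (to1 (to2 (hF K hK))) (hi J hJ K hK) (h0 K hK i hiK)
  · intro h; exact absurd hJ h

theorem ustat (m : ι → MeasurableSpace Ω) (hm : ∀ i, m i ≤ mΩ)
    (hcomm : ∀ i j (f : Ω → ℝ), μ[μ[f|m j]|m i] =ᵐ[μ] μ[μ[f|m i]|m j])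
    (d : ℕ) (hd : 1 ≤ d) (A : Finset (Finset ι)) (F : Finset ι → Ω → ℝ)
    (hcard : ∀ J ∈ A, J.card = d) (hF : ∀ J ∈ A, MemLp (F J) 4 μ)
    (hmeas : ∀ J ∈ A, ∀ i, i ∉ J → StronglyMeasurable[m i] (F J))
    (h0 : ∀ J ∈ A, ∀ i ∈ J, μ[F J|m i] =ᵐ[μ] 0)
    (W : Ω → ℝ) (hWs : ∀ ω, W ω = ∑ J ∈ A, F J ω) (ν : ℝ) (hν : 0 < ν)
    (EW : ∫ ω, W ω ∂μ = 0) (EW2 : ∫ ω, W ω ^ 2 ∂μ = 2 * ν)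
    (D ρ2 : ℝ) (hD0 : 0 ≤ D) (hρ0 : 0 ≤ ρ2)
    (hD : ∀ J ∈ A, ∫ ω, F J ω ^ 4 ∂μ ≤ D * (∫ ω, F J ω ^ 2 ∂μ) ^ 2)
    (hρ : ∀ i, ∑ J ∈ A with i ∈ J, ∫ ω, F J ω ^ 2 ∂μ ≤ ρ2)
    (h h1 h2 : ℝ → ℝ) (hh : ∀ t, HasDerivAt h (h1 t) t)
    (hh1 : ∀ t, HasDerivAt h1 (h2 t) t) (hh2 : Continuous h2) (b1 : ∀ t, |h1 t| ≤ 1)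
    (b2 : ∀ t, |h2 t| ≤ 1) :
    |(∫ ω, h (W ω) ∂μ) - ∫ z, h z ∂(centeredGammaLaw ν)| ≤
      (max 1 (2 / ν) / √3) * √|(∫ ω, W ω ^ 4 ∂μ) - 12 * (∫ ω, W ω ^ 3 ∂μ) - 12 * ν ^ 2 + 48 * ν|
      + (2 * max 1 (2 / ν) * √ν / √3 + 24 * max 1 (2 / ν)) * √(16 ^ d * D * ρ2) := by
  have hWf : W = fun ω => ∑ J ∈ A, F J ω := funext hWs
  have W4 : MemLp W 4 μ := by rw [hWf]; exact memLp_finsetSum _ hF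
  have hAne : A.Nonempty := by
    rw [Finset.nonempty_iff_ne_empty]
    rintro rfl
    simp [hWf] at EW2
    exact hν.ne' EW2
  set G : ι → Ω → ℝ := fun i ω => ∑ J ∈ A with i ∈ J, F J ω with hG
  set V : ι → Ω → ℝ := fun i ω => ∑ J ∈ A with i ∉ J, F J ω with hV
  have sub1 : ∀ i, ∀ J ∈ A.filter (fun J => i ∈ J), J ∈ A := fun i J hJ => (Finset.mem_filter.1 hJ).1
  have sub2 : ∀ i, ∀ J ∈ A.filter (fun J => i ∉ J), J ∈ A := fun i J hJ => (Finset.mem_filter.1 hJ).1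
  have G4 : ∀ i, MemLp (G i) 4 μ := fun i => memLp_finsetSum _ fun J hJ => hF J (sub1 i J hJ)
  have V4 : ∀ i, MemLp (V i) 4 μ := fun i => memLp_finsetSum _ fun J hJ => hF J (sub2 i J hJ)
  have G0 : ∀ i, μ[G i|m i] =ᵐ[μ] 0 := by
    intro i
    have e1 : G i = ∑ J ∈ A with i ∈ J, F J := by ext ω; simp [hG]
    have a1 := condExp_finsetSum (μ := μ) (s := A.filter fun J => i ∈ J) (f := F)
      (fun J hJ => to1 (to2 (hF J (sub1 i J hJ)))) (m i)
    rw [e1]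
    refine a1.trans ?_
    have a2 : ∀ᵐ ω ∂μ, ∀ J ∈ A.filter (fun J => i ∈ J), (μ[F J|m i]) ω = 0 := by
      rw [Filter.eventually_all_finset]
      intro J hJ
      exact h0 J (sub1 i J hJ) i (Finset.mem_filter.1 hJ).2
    filter_upwards [a2] with ω hω
    rw [Finset.sum_apply, Finset.sum_eq_zero hω]; rfl
  have mV : ∀ i, StronglyMeasurable[m i] (V i) := fun i =>
    Finset.stronglyMeasurable_fun_sum _ fun J hJ => hmeas J (sub2 i J hJ) i (Finset.mem_filter.1 hJ).2
  set e : ι → Ω → ℝ := fun i => μ[fun ω => G i ω ^ 2|m i] with he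
  set S : Ω → ℝ := fun ω => (1 / (d : ℝ)) * ∑ i, (1 / 2 : ℝ) * (G i ω ^ 2 + e i ω) with hS
  have hd0 : (0 : ℝ) < d := by exact_mod_cast hd
  have gl : Glob mΩ μ m V G e W S (d : ℝ) ν :=
    { one := fun i => One.mk' (hm i) (V4 i) (G4 i) (mV i) (G0 i)
      hW := fun i ω => by
        rw [hWs, add_comm]; exact Finset.sum_filter_add_sum_filter_not _ _ _
      hs := fun ω => by
        simp only [hG, Finset.sum_filter]
        rw [Finset.sum_comm, hWs, Finset.mul_sum]
        refine Finset.sum_congr rfl fun J hJ => ?_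
        rw [← Finset.sum_filter, Finset.sum_const, nsmul_eq_mul]
        simp [hcard J hJ]
      hd := hd0
      W4 := W4
      EW := EW
      EW2 := EW2
      hS := fun ω => rfl }
  have hAV := gl.AV hcomm A id F d rfl (fun J hJ => (hcard J hJ).le) hF hmeas hWs hAne
  -- fourth moments
  set K := 16 ^ d * D * ρ2 with hK
  have hK0 : 0 ≤ K := by positivity
  have g2 : ∀ i, ∫ ω, G i ω ^ 2 ∂μ = ∑ J ∈ A with i ∈ J, ∫ ω, F J ω ^ 2 ∂μ := fun i =>
    sum_sq_orth m hm d _ F (fun J hJ => hcard J (sub1 i J hJ)) (fun J hJ => hF J (sub1 i J hJ))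
      (fun J hJ => hmeas J (sub1 i J hJ)) (fun J hJ => h0 J (sub1 i J hJ))
  have g20 : ∀ i, 0 ≤ ∫ ω, G i ω ^ 2 ∂μ := fun i => integral_nonneg fun ω => sq_nonneg _
  have g4 : ∀ i, ∫ ω, G i ω ^ 4 ∂μ ≤ K * ∫ ω, G i ω ^ 2 ∂μ := by
    intro i
    have a1 := hyper μ m hm F Finset.univ d (A.filter fun J => i ∈ J) id (Set.injOn_id _)
      (fun J _ => Finset.subset_univ _) (fun J hJ => (hcard J (sub1 i J hJ)).le)
      (fun J hJ => hF J (sub1 i J hJ)) (fun J hJ i' _ => hmeas J (sub1 i J hJ) i')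
      (fun J hJ => h0 J (sub1 i J hJ))
    have a2 : ∑ J ∈ A with i ∈ J, √(∫ ω, F J ω ^ 4 ∂μ) ≤ √D * ∫ ω, G i ω ^ 2 ∂μ := by
      rw [g2, Finset.mul_sum]
      refine Finset.sum_le_sum fun J hJ => ?_
      refine (Real.sqrt_le_sqrt (hD J (sub1 i J hJ))).trans (le_of_eq ?_)
      rw [Real.sqrt_mul hD0, Real.sqrt_sq (integral_nonneg fun ω => sq_nonneg _)]
    have a3 : 0 ≤ ∑ J ∈ A with i ∈ J, √(∫ ω, F J ω ^ 4 ∂μ) :=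
      Finset.sum_nonneg fun J _ => Real.sqrt_nonneg _
    have a4 : ∫ ω, G i ω ^ 2 ∂μ ≤ ρ2 := (g2 i).le.trans (hρ i)
    calc ∫ ω, G i ω ^ 4 ∂μ ≤ 16 ^ d * (∑ J ∈ A with i ∈ J, √(∫ ω, F J ω ^ 4 ∂μ)) ^ 2 := a1
      _ ≤ 16 ^ d * (√D * ∫ ω, G i ω ^ 2 ∂μ) ^ 2 := by gcongr
      _ = 16 ^ d * D * ((∫ ω, G i ω ^ 2 ∂μ) * ∫ ω, G i ω ^ 2 ∂μ) := by
        rw [mul_pow, Real.sq_sqrt hD0]; ring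
      _ ≤ 16 ^ d * D * (ρ2 * ∫ ω, G i ω ^ 2 ∂μ) := by
        have := g20 i
        gcongr
      _ = _ := by rw [hK]; ring
  have s4 : (2 / (d : ℝ)) * ∑ i, ∫ ω, G i ω ^ 4 ∂μ ≤ 4 * (K * ν) := by
    have := Finset.sum_le_sum fun i (_ : i ∈ Finset.univ) => g4 i
    rw [← Finset.mul_sum, gl.sumG2] at this
    rw [div_mul_eq_mul_div, div_le_iff₀ hd0]
    linarith
  have s24 : ∑ i, √(∫ ω, G i ω ^ 2 ∂μ) * √(∫ ω, G i ω ^ 4 ∂μ) ≤ √K * (d * (2 * ν)) := by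
    rw [← gl.sumG2, Finset.mul_sum]
    refine Finset.sum_le_sum fun i _ => ?_
    calc _ ≤ √(∫ ω, G i ω ^ 2 ∂μ) * √(K * ∫ ω, G i ω ^ 2 ∂μ) := by
          have := Real.sqrt_le_sqrt (g4 i); gcongr
      _ = √K * (√(∫ ω, G i ω ^ 2 ∂μ) * √(∫ ω, G i ω ^ 2 ∂μ)) := by
          rw [Real.sqrt_mul hK0]; ring
      _ = _ := by rw [Real.mul_self_sqrt (g20 i)]
  set Q := (∫ ω, W ω ^ 4 ∂μ) - 12 * (∫ ω, W ω ^ 3 ∂μ) - 12 * ν ^ 2 + 48 * ν with hQ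
  -- L2 norm
  have hL2 : √(∫ ω, (S ω - 2 * ν - 2 * W ω) ^ 2 ∂μ) ≤ (√|Q| + 2 * (√ν * √K)) / √3 := by
    apply Real.sqrt_le_iff.2
    refine ⟨by positivity, ?_⟩
    rw [div_pow, Real.sq_sqrt (by norm_num : (0 : ℝ) ≤ 3)]
    have q1 : √|Q| ^ 2 = |Q| := Real.sq_sqrt (abs_nonneg _)
    have q2 : (√ν * √K) ^ 2 = ν * K := by
      rw [mul_pow, Real.sq_sqrt hν.le, Real.sq_sqrt hK0]
    have q3 : 0 ≤ √|Q| * (√ν * √K) := by positivity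
    have q4 := le_abs_self Q
    rw [le_div_iff₀ (by norm_num)]
    nlinarith
  -- Stein
  obtain ⟨f, f1, hf, bf, bf1, lf, hst⟩ := stein_eq ν hν h h1 h2 hh hh1 hh2 b1 b2
  set mm := max 1 (2 / ν) with hmm
  have hm1 : 1 ≤ mm := le_max_left _ _
  set M := (1 + 2 * mm) / (2 + ν / 2) with hM
  have hM0 : 0 ≤ M := by positivity
  have hMν : M * ν ≤ 6 * mm := by
    rw [hM, div_mul_eq_mul_div, div_le_iff₀ (by positivity)]
    nlinarith
  have hstein := gl.stein f f1 hf 1 mm M hM0 bf bf1 lf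
  have fc : Continuous f := continuous_iff_continuousAt.2 fun t => (hf t).continuousAt
  have f1c : Continuous f1 := by
    have : LipschitzWith (Real.toNNReal M) f1 := LipschitzWith.of_dist_le_mul fun x y => by
      rw [Real.dist_eq, Real.dist_eq, Real.coe_toNNReal _ hM0]; exact lf x y
    exact this.continuous
  have bd : ∀ (φ : ℝ → ℝ) (c : ℝ), Continuous φ → (∀ t, |φ t| ≤ c) → ∀ (Z : Ω → ℝ),
      Integrable Z μ → Integrable (fun ω => φ (W ω) * Z ω) μ :=
    fun φ c hφ hc Z hZ => hZ.bdd_mul (hφ.comp_aestronglyMeasurable W4.1)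
      (ae_of_all _ fun ω => (hc (W ω)))
  have iW := to1 (to2 W4)
  have hRl : MemLp (fun ω => S ω - 2 * ν - 2 * W ω) 2 μ :=
    (gl.S2.sub (memLp_const (2 * ν))).sub ((to2 W4).const_mul 2)
  have c1 := bd f 1 fc bf W iW
  have c2 := bd f1 mm f1c bf1 S (to1 gl.S2)
  have c3 := bd f1 mm f1c bf1 _ (to1 hRl)
  have hc : Continuous h := continuous_iff_continuousAt.2 fun t => (hh t).continuousAt
  have key : (∫ ω, h (W ω) ∂μ) - ∫ z, h z ∂(centeredGammaLaw ν)
      = (-∫ ω, f1 (W ω) * (S ω - 2 * ν - 2 * W ω) ∂μ)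
        - ((∫ ω, f (W ω) * W ω ∂μ) - ∫ ω, f1 (W ω) * S ω ∂μ) := by
    set c := ∫ z, h z ∂(centeredGammaLaw ν) with hcdef
    have e1 : ∀ ω, h (W ω) = (((-1) * (f1 (W ω) * (S ω - 2 * ν - 2 * W ω))
        + f1 (W ω) * S ω) - f (W ω) * W ω) + c := fun ω => by
      have := hst (W ω)
      linarith
    simp_rw [e1]
    rw [integral_add (isub (iadd (c3.const_mul _) c2) c1) (integrable_const _),
      integral_sub (iadd (c3.const_mul _) c2) c1, integral_add (c3.const_mul _) c2,
      integral_const_mul, integral_const, probReal_univ]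
    simp only [smul_eq_mul]
    ring
  have r1 : |∫ ω, f1 (W ω) * (S ω - 2 * ν - 2 * W ω) ∂μ| ≤ mm * ((√|Q| + 2 * (√ν * √K)) / √3) := by
    have k1 := cs (memLp_const (1 : ℝ)) hRl.abs
    calc _ ≤ ∫ ω, |f1 (W ω) * (S ω - 2 * ν - 2 * W ω)| ∂μ := abs_integral_le_integral_abs
      _ ≤ ∫ ω, mm * |S ω - 2 * ν - 2 * W ω| ∂μ := by
        refine integral_mono c3.abs ((to1 hRl).abs.const_mul _) fun ω => ?_
        simp only [abs_mul]
        exact mul_le_mul_of_nonneg_right (bf1 _) (abs_nonneg _)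
      _ = mm * ∫ ω, |S ω - 2 * ν - 2 * W ω| ∂μ := integral_const_mul _ _
      _ ≤ mm * √(∫ ω, (S ω - 2 * ν - 2 * W ω) ^ 2 ∂μ) := by
        refine mul_le_mul_of_nonneg_left ((le_abs_self _).trans ?_) (by linarith)
        simpa using k1
      _ ≤ _ := mul_le_mul_of_nonneg_left hL2 (by linarith)
  have r2 : (2 * M / (d : ℝ)) * ∑ i, √(∫ ω, G i ω ^ 2 ∂μ) * √(∫ ω, G i ω ^ 4 ∂μ)
      ≤ 24 * mm * √K := by
    calc _ ≤ (2 * M / (d : ℝ)) * (√K * (d * (2 * ν))) := by gcongr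
      _ = 4 * (M * ν) * √K := by field_simp; ring
      _ ≤ 4 * (6 * mm) * √K := by gcongr
      _ = _ := by ring
  rw [key]
  have t1 := abs_sub (-∫ ω, f1 (W ω) * (S ω - 2 * ν - 2 * W ω) ∂μ)
    ((∫ ω, f (W ω) * W ω ∂μ) - ∫ ω, f1 (W ω) * S ω ∂μ)
  rw [abs_neg] at t1
  calc _ ≤ _ := t1
    _ ≤ mm * ((√|Q| + 2 * (√ν * √K)) / √3) + 24 * mm * √K := add_le_add r1 (hstein.trans r2)
    _ = _ := by ring

end ustat
end DJ

namespace DJ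

lemma comm_of_indep {Ω : Type*} {n : ℕ} (k : Fin n → MeasurableSpace Ω) [mΩ : MeasurableSpace Ω]
    {μ : Measure Ω} [IsProbabilityMeasure μ] (hk : ∀ i, k i ≤ mΩ) (hi : iIndep k μ)
    (i j : Fin n) (f : Ω → ℝ) :
    μ[μ[f|⨆ a ∈ Finset.univ.erase j, k a]|⨆ a ∈ Finset.univ.erase i, k a] =ᵐ[μ]
      μ[μ[f|⨆ a ∈ Finset.univ.erase i, k a]|⨆ a ∈ Finset.univ.erase j, k a] := by
  by_cases hij : i = j
  · subst hij; rfl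
  have split : ∀ i j : Fin n, i ≠ j → (⨆ a ∈ Finset.univ.erase j, k a)
      = (⨆ a ∈ (Finset.univ.erase i).erase j, k a) ⊔ k i := by
    intro i j hij
    apply le_antisymm
    · refine iSup₂_le fun a ha => ?_
      by_cases hai : a = i
      · subst hai; exact le_sup_right
      · exact le_sup_of_le_left (le_iSup₂_of_le a (by simp at ha; simp [ha, hai]) le_rfl)
    · refine sup_le (iSup₂_le fun a ha => ?_) ?_
      · exact le_iSup₂_of_le a (by simp at ha; simp [ha]) le_rfl
      · exact le_iSup₂_of_le i (by simp [hij]) le_rfl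
  have ind : ∀ i j : Fin n, i ≠ j →
      Indep ((⨆ a ∈ (Finset.univ.erase i).erase j, k a) ⊔ k i) (k j) μ := by
    intro i j hij
    rw [← split i j hij]
    have := indep_iSup_of_disjoint hk hi (S := {a | a ∈ Finset.univ.erase j}) (T := {j})
      (by simp)
    simpa using this
  have h1 : (⨆ a ∈ (Finset.univ.erase i).erase j, k a) ≤ mΩ := iSup₂_le fun a _ => hk a
  have e2 : (⨆ a ∈ Finset.univ.erase i, k a)
      = (⨆ a ∈ (Finset.univ.erase i).erase j, k a) ⊔ k j := by
    rw [split j i (Ne.symm hij), Finset.erase_right_comm]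
  have e1 := split i j hij
  have ind2 : Indep ((⨆ a ∈ (Finset.univ.erase i).erase j, k a) ⊔ k j) (k i) μ := by
    rw [Finset.erase_right_comm]; exact ind j i (Ne.symm hij)
  rw [e1, e2]
  exact (condExp_comm h1 (hk i) (hk j) (ind i j hij)).trans
    (condExp_comm h1 (hk j) (hk i) ind2).symm

end DJ

/-- Theorem `maintheo`, non-central de Jong theorem: for every `d ≥ 1` there
is a finite constant `C_d > 0` such that for every degenerate `U`-statistic
`W = ∑_{|J| = d} W_J` of order `d` in `n ≥ d` independent random variables with `W ∈ L⁴`,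
`E[W] = 0`, `E[W²] = 2ν`, and with `ρ_n²`, `D_n` as described,
`d₂(W, Z_ν) ≤ (max(1, 2/ν)/√3) √|E[W⁴] − 12 E[W³] − 12ν² + 48ν|
  + (((2√3 + 4√ν) max(1, 2/ν) + 4√ν)/(3√d)) √(C_d D_n ρ_n²)`. -/
theorem nonCentral_deJong :
    ∀ d : ℕ, 1 ≤ d → ∃ C : ℝ, 0 < C ∧
      ∀ (n : ℕ), d ≤ n →
      ∀ (Ω : Type) [MeasurableSpace Ω] (μ : Measure Ω), IsProbabilityMeasure μ →
      ∀ (E : Fin n → Type) (mE : ∀ i, MeasurableSpace (E i)) (X : ∀ i, Ω → E i),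
        (∀ i, @Measurable Ω (E i) _ (mE i) (X i)) →
        iIndepFun (m := mE) X μ →
      ∀ (ν : ℝ), 0 < ν →
      ∀ (WJ : Finset (Fin n) → Ω → ℝ) (W : Ω → ℝ),
        W = (fun ω => ∑ J ∈ Finset.powersetCard d (Finset.univ : Finset (Fin n)), WJ J ω) →
        (∀ J ∈ Finset.powersetCard d (Finset.univ : Finset (Fin n)),
          Measurable[⨆ j ∈ J, (mE j).comap (X j)] (WJ J)) →
        (∀ J ∈ Finset.powersetCard d (Finset.univ : Finset (Fin n)), MemLp (WJ J) 4 μ) →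
        (∀ J ∈ Finset.powersetCard d (Finset.univ : Finset (Fin n)), ∀ K : Finset (Fin n),
          ¬ J ⊆ K → μ[WJ J|⨆ j ∈ K, (mE j).comap (X j)] =ᵐ[μ] 0) →
        MemLp W 4 μ →
        (∫ ω, W ω ∂μ) = 0 →
        (∫ ω, (W ω) ^ 2 ∂μ) = 2 * ν →
      ∀ ρ2 D : ℝ,
        ρ2 = sSup {c | ∃ i : Fin n,
          c = ∑ K ∈ (Finset.powersetCard d (Finset.univ : Finset (Fin n))).filter
                (fun K => i ∈ K), variance (WJ K) μ} →
        D = sSup {c | ∃ J ∈ Finset.powersetCard d (Finset.univ : Finset (Fin n)),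
          c = (∫ ω, (WJ J ω) ^ 4 ∂μ) / (variance (WJ J) μ) ^ 2} →
        d2Dist (μ.map W) (centeredGammaLaw ν)
          ≤ (max 1 (2 / ν) / Real.sqrt 3) *
              Real.sqrt |(∫ ω, (W ω) ^ 4 ∂μ) - 12 * (∫ ω, (W ω) ^ 3 ∂μ)
                - 12 * ν ^ 2 + 48 * ν|
            + (((2 * Real.sqrt 3 + 4 * Real.sqrt ν) * max 1 (2 / ν) + 4 * Real.sqrt ν)
                / (3 * Real.sqrt d)) * Real.sqrt (C * D * ρ2) := by
  intro d hd
  have hd0 : (0 : ℝ) < d := by exact_mod_cast hd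
  refine ⟨441 * d * 16 ^ d, by positivity, ?_⟩
  intro n hdn Ω mΩ μ hμ E mE X hX hind ν hν WJ W hW hmeas hL4 hdeg hW4 hEW hEW2 ρ2 D hρ2 hD
  set A := Finset.powersetCard d (Finset.univ : Finset (Fin n)) with hA
  set k : Fin n → MeasurableSpace Ω := fun j => (mE j).comap (X j) with hk
  have hkle : ∀ i, k i ≤ mΩ := fun i => (hX i).comap_le
  have hii : iIndep k μ := hind
  set m : Fin n → MeasurableSpace Ω := fun i => ⨆ a ∈ Finset.univ.erase i, k a with hm
  have hmle : ∀ i, m i ≤ mΩ := fun i => iSup₂_le fun a _ => hkle a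
  have hcard : ∀ J ∈ A, J.card = d := fun J hJ => (Finset.mem_powersetCard.1 hJ).2
  have hsm : ∀ J ∈ A, ∀ i, i ∉ J → StronglyMeasurable[m i] (WJ J) := by
    intro J hJ i hi
    have h1 : (⨆ j ∈ J, k j) ≤ m i := iSup₂_le fun a ha =>
      le_iSup₂_of_le (f := fun a (_ : a ∈ Finset.univ.erase i) => k a) a
        (by simp only [Finset.mem_erase, Finset.mem_univ, and_true]; rintro rfl; exact hi ha) le_rfl
    exact ((hmeas J hJ).mono h1 le_rfl).stronglyMeasurable
  have h0 : ∀ J ∈ A, ∀ i ∈ J, μ[WJ J|m i] =ᵐ[μ] 0 := fun J hJ i hi =>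
    hdeg J hJ (Finset.univ.erase i) (fun hs => by simpa using hs hi)
  have hmean : ∀ J ∈ A, ∫ ω, WJ J ω ∂μ = 0 := by
    intro J hJ
    have hne : J.Nonempty := Finset.card_pos.1 (by rw [hcard J hJ]; omega)
    obtain ⟨i, hi⟩ := hne
    rw [← integral_condExp (hmle i), integral_congr_ae (h0 J hJ i hi)]; simp
  have hvar : ∀ J ∈ A, variance (WJ J) μ = ∫ ω, WJ J ω ^ 2 ∂μ := fun J hJ =>
    variance_of_integral_eq_zero (hL4 J hJ).1.aemeasurable (hmean J hJ)
  -- bounds for ρ2 and D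
  have hbdρ : BddAbove {c | ∃ i : Fin n, c = ∑ K ∈ A.filter (fun K => i ∈ K), variance (WJ K) μ} := by
    have : {c | ∃ i : Fin n, c = ∑ K ∈ A.filter (fun K => i ∈ K), variance (WJ K) μ}
      = Set.range fun i : Fin n => ∑ K ∈ A.filter (fun K => i ∈ K), variance (WJ K) μ := by
      ext c; simp [eq_comm]
    rw [this]; exact (Set.finite_range _).bddAbove
  have hbdD : BddAbove {c | ∃ J ∈ A, c = (∫ ω, (WJ J ω) ^ 4 ∂μ) / (variance (WJ J) μ) ^ 2} := by
    have : {c | ∃ J ∈ A, c = (∫ ω, (WJ J ω) ^ 4 ∂μ) / (variance (WJ J) μ) ^ 2}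
      = Set.image (fun J => (∫ ω, (WJ J ω) ^ 4 ∂μ) / (variance (WJ J) μ) ^ 2) (A : Set (Finset (Fin n))) := by
      ext c; simp [eq_comm]
    rw [this]; exact (A.finite_toSet.image _).bddAbove
  have h4nn : ∀ J, 0 ≤ ∫ ω, (WJ J ω) ^ 4 ∂μ := fun J => integral_nonneg fun ω => by positivity
  have hρ0 : 0 ≤ ρ2 := by
    rw [hρ2]; apply Real.sSup_nonneg
    rintro c ⟨i, rfl⟩
    exact Finset.sum_nonneg fun J _ => variance_nonneg _ _
  have hD0 : 0 ≤ D := by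
    rw [hD]; apply Real.sSup_nonneg
    rintro c ⟨J, _, rfl⟩
    exact div_nonneg (h4nn J) (sq_nonneg _)
  have hρb : ∀ i, ∑ J ∈ A with i ∈ J, ∫ ω, WJ J ω ^ 2 ∂μ ≤ ρ2 := by
    intro i
    rw [hρ2]
    refine le_csSup_of_le hbdρ ⟨i, rfl⟩ (le_of_eq ?_)
    exact Finset.sum_congr rfl fun J hJ => (hvar J (Finset.mem_filter.1 hJ).1).symm
  have hDb : ∀ J ∈ A, ∫ ω, WJ J ω ^ 4 ∂μ ≤ D * (∫ ω, WJ J ω ^ 2 ∂μ) ^ 2 := by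
    intro J hJ
    have h1 : (∫ ω, (WJ J ω) ^ 4 ∂μ) / (variance (WJ J) μ) ^ 2 ≤ D := by
      rw [hD]; exact le_csSup hbdD ⟨J, hJ, rfl⟩
    rw [hvar J hJ] at h1
    rcases eq_or_lt_of_le (integral_nonneg fun ω => sq_nonneg (WJ J ω) :
      0 ≤ ∫ ω, WJ J ω ^ 2 ∂μ) with hz | hz
    · have h2 := (integral_eq_zero_iff_of_nonneg (fun ω => sq_nonneg (WJ J ω))
        (DJ.to1 (DJ.sq42 (hL4 J hJ)))).1 hz.symm
      have h3 : ∫ ω, WJ J ω ^ 4 ∂μ = 0 := by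
        rw [← integral_zero Ω ℝ (μ := μ)]
        apply integral_congr_ae
        filter_upwards [h2] with ω hω
        have : WJ J ω ^ 2 = 0 := hω
        have : WJ J ω = 0 := by simpa using this
        simp [this]
      rw [h3]; positivity
    · rwa [div_le_iff₀ (by positivity)] at h1
  -- constants
  set mm := max 1 (2 / ν) with hmm
  have hm1 : 1 ≤ mm := le_max_left _ _
  set Q := (∫ ω, (W ω) ^ 4 ∂μ) - 12 * (∫ ω, (W ω) ^ 3 ∂μ) - 12 * ν ^ 2 + 48 * ν with hQ
  have hconst : (mm / √3) * √|Q| + (2 * mm * √ν / √3 + 24 * mm) * √(16 ^ d * D * ρ2)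
      ≤ mm / √3 * √|Q| + (((2 * √3 + 4 * √ν) * mm + 4 * √ν) / (3 * √d))
        * √(441 * d * 16 ^ d * D * ρ2) := by
    have e1 : √(441 * d * 16 ^ d * D * ρ2) = 21 * √d * √(16 ^ d * D * ρ2) := by
      rw [show 441 * (d : ℝ) * 16 ^ d * D * ρ2 = (21 ^ 2 * d) * (16 ^ d * D * ρ2) by ring,
        Real.sqrt_mul (by positivity), Real.sqrt_mul (by positivity),
        Real.sqrt_sq (by norm_num)]
    have hsd : 0 < √(d : ℝ) := Real.sqrt_pos.2 hd0
    rw [e1]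
    have e2 : (((2 * √3 + 4 * √ν) * mm + 4 * √ν) / (3 * √d)) * (21 * √d * √(16 ^ d * D * ρ2))
      = (7 * ((2 * √3 + 4 * √ν) * mm + 4 * √ν)) * √(16 ^ d * D * ρ2) := by
      field_simp; ring
    rw [e2]
    have s3 : (12 / 7 : ℝ) ≤ √3 := Real.le_sqrt_of_sq_le (by norm_num)
    have hsν : 0 ≤ √ν := Real.sqrt_nonneg _
    have e3 : 2 * mm * √ν / √3 ≤ 2 * mm * √ν := div_le_self (by positivity) (by linarith)
    have e4 : 0 ≤ mm * √ν := by positivity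
    have e5 : mm * (12 / 7) ≤ mm * √3 := by gcongr
    gcongr
    nlinarith
  -- conclusion
  have hWm : AEMeasurable W μ := hW4.1.aemeasurable
  have hP : IsProbabilityMeasure (μ.map W) := Measure.isProbabilityMeasure_map hWm
  have hQp := DJ.cgl_prob ν hν
  have hPi : Integrable (fun x : ℝ => x) (μ.map W) := by
    rw [integrable_map_measure (by fun_prop) hWm]
    exact DJ.to1 (DJ.to2 hW4)
  refine le_trans ?_ hconst
  unfold d2Dist
  apply Real.sSup_le
  · rintro c ⟨h, hh, rfl⟩
    refine DJ.reduceC2 (μ.map W) (centeredGammaLaw ν) hPi (DJ.cgl_integrable ν hν) _ ?_ h hh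
    intro g g1 g2 dg dg1 cg2 bg1 bg2
    have gc : Continuous g := continuous_iff_continuousAt.2 fun t => (dg t).continuousAt
    rw [integral_map hWm gc.aestronglyMeasurable]
    exact DJ.ustat m hmle (DJ.comm_of_indep k hkle hii) d hd A WJ hcard hL4 hsm h0 W
      (fun ω => congrFun hW ω) ν hν hEW hEW2 D ρ2 hD0 hρ0 hDb hρb g g1 g2 dg dg1 cg2 bg1 bg2
  · positivity
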